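/- arXiv:cond-mat/0211623 — 2 statements merged into one kernel-verified Lean document; each statement's English description precedes it below -/
import Mathlib

section
/- For every even integer L ≥ 2, the quantity 2·N_D(L) − N_C(L) equals the central binomial coefficient binom(L, L/2). (This is the even-width case of Theorem 1: 2·N_{Z,sq,PF,L} − N_{Z,tri,PF,L} = N_{Z,sqtri,FP,L/2} = binom(L, L/2).) -/
/-- Four points of `ZMod L` occur in this (strict) cyclic order around the circle. -/
def CycOrd (L : ℕ) (a b c d : ZMod L) : Prop :=
  ∃ t : ZMod L, (a - t).val < (b - t).val ∧ (b - t).val < (c - t).val ∧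
    (c - t).val < (d - t).val

/-- A partition (setoid) of `ZMod L` is non-crossing: there are no four points
`a, b, c, d` in cyclic order with `a ~ c`, `b ~ d` but `a` and `b` in different blocks. -/
def IsNC (L : ℕ) (P : Setoid (ZMod L)) : Prop :=
  ¬ ∃ a b c d : ZMod L, CycOrd L a b c d ∧ P.r a c ∧ P.r b d ∧ ¬ P.r a b

/-- The set of non-crossing partitions of `ZMod L`. -/
def NCPart (L : ℕ) := {P : Setoid (ZMod L) // IsNC L P}

/-- Two non-crossing partitions are related by a rotation `x ↦ x + t`. -/
def rotRel (L : ℕ) (P Q : NCPart L) : Prop :=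
  ∃ t : ZMod L, ∀ x y : ZMod L, P.1.r x y ↔ Q.1.r (x + t) (y + t)

/-- Two non-crossing partitions are related by an element of the dihedral group,
i.e. by a map `x ↦ x + t` or `x ↦ -x + t`. -/
def dihRel (L : ℕ) (P Q : NCPart L) : Prop :=
  ∃ t : ZMod L, (∀ x y : ZMod L, P.1.r x y ↔ Q.1.r (x + t) (y + t)) ∨
    (∀ x y : ZMod L, P.1.r x y ↔ Q.1.r (-x + t) (-y + t))

/-- `N_C L`: the number of orbits of non-crossing partitions of `ZMod L`
under the rotation action (the paper's `N_{Z,tri,PF,L}`). -/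
noncomputable def N_C (L : ℕ) : ℕ := Nat.card (Quot (rotRel L))

/-- `N_D L`: the number of orbits of non-crossing partitions of `ZMod L`
under the dihedral action (the paper's `N_{Z,sq,PF,L}`). -/
noncomputable def N_D (L : ℕ) : ℕ := Nat.card (Quot (dihRel L))


def FNC {n : ℕ} (P : Setoid (Fin n)) : Prop :=
  ∀ a b c d : Fin n, a < b → b < c → c < d → P.r a c → P.r b d → P.r a b

namespace Stat

variable {n : ℕ}

def A (O : Finset (Fin n)) (x : ℕ) : ℤ := ((O.filter (fun i => i.val < x)).card : ℤ)

def EE (O : Finset (Fin n)) (x : ℕ) : ℤ := A O x + A O (n - x) - O.card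

def NN (O : Finset (Fin n)) (x : ℕ) : ℤ := A O (x + 1) + A O (n - x) - O.card

lemma A_zero (O : Finset (Fin n)) : A O 0 = 0 := by simp [A]

lemma A_n (O : Finset (Fin n)) : A O n = O.card := by simp [A]

lemma A_succ (O : Finset (Fin n)) (i : Fin n) :
    A O (i.val + 1) = A O i.val + if i ∈ O then 1 else 0 := by
  unfold A
  have h : O.filter (fun j => j.val < i.val + 1) =
      O.filter (fun j => j.val < i.val) ∪ O.filter (fun j => j = i) := by
    ext j; simp only [Finset.mem_filter, Finset.mem_union, Fin.ext_iff]
    constructor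
    · rintro ⟨h1, h2⟩
      rcases Nat.lt_succ_iff_lt_or_eq.mp h2 with h | h <;> tauto
    · rintro (⟨h1, h2⟩ | ⟨h1, h2⟩) <;> exact ⟨h1, by omega⟩
  rw [h, Finset.card_union_of_disjoint]
  · rw [Finset.filter_eq']; split_ifs <;> simp
  · rw [Finset.disjoint_left]
    intro j hj hj'
    simp only [Finset.mem_filter] at hj hj'
    have := hj'.2; subst this; omega

lemma EE_zero (O : Finset (Fin n)) : EE O 0 = 0 := by simp [EE, A_zero, A_n]

lemma EE_n (O : Finset (Fin n)) : EE O n = 0 := by simp [EE, A_zero, A_n]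

lemma EE_symm (O : Finset (Fin n)) (x : ℕ) (hx : x ≤ n) : EE O (n - x) = EE O x := by
  unfold EE; rw [show n - (n - x) = x by omega]; ring

lemma NN_symm (O : Finset (Fin n)) (i : Fin n) : NN O i.rev.val = NN O i.val := by
  unfold NN; rw [Fin.val_rev]
  rw [show n - (n - (i.val + 1)) = i.val + 1 by omega, show n - (i.val + 1) + 1 = n - i.val by omega]
  ring

lemma NN_eq (O : Finset (Fin n)) (i : Fin n) :
    NN O i.val = EE O i.val + if i ∈ O then 1 else 0 := by
  unfold NN EE; rw [A_succ]; ring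

lemma EE_succ (O : Finset (Fin n)) (i : Fin n) :
    EE O (i.val + 1) = NN O i.val - if i.rev ∈ O then 1 else 0 := by
  unfold NN EE
  have := A_succ O i.rev
  rw [Fin.val_rev, show n - (i.val + 1) + 1 = n - i.val by omega] at this
  rw [this]; ring

lemma EE_le_NN (O : Finset (Fin n)) (i : Fin n) : EE O i.val ≤ NN O i.val := by
  rw [NN_eq]; split_ifs <;> simp

def Rel (O : Finset (Fin n)) (x y : Fin n) : Prop :=
  NN O x.val = NN O y.val ∧
    ∀ z : ℕ, (x.val < z ∧ z ≤ y.val ∨ y.val < z ∧ z ≤ x.val) → NN O x.val ≤ EE O z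

def RS (O : Finset (Fin n)) : Setoid (Fin n) where
  r := Rel O
  iseqv := by
    refine ⟨fun x => ⟨rfl, fun z hz => by omega⟩, fun {x y} h => ⟨h.1.symm, fun z hz => ?_⟩,
      fun {x y w} h h' => ⟨h.1.trans h'.1, fun z hz => ?_⟩⟩
    · rw [← h.1]; exact h.2 z (by tauto)
    · by_cases hh : x.val < z ∧ z ≤ y.val ∨ y.val < z ∧ z ≤ x.val
      · exact h.2 z hh
      · rw [h.1]; exact h'.2 z (by omega)

lemma RS_fnc (O : Finset (Fin n)) : FNC (RS O) := by
  intro a b c d hab hbc hcd hac hbd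
  rw [Fin.lt_def] at *
  obtain ⟨h1, h2⟩ := hac
  obtain ⟨h3, h4⟩ := hbd
  have e1 := h2 b.val (by omega)
  have e2 := h4 c.val (by omega)
  have e3 := EE_le_NN O b
  have e4 := EE_le_NN O c
  exact ⟨by omega, fun z hz => h2 z (by omega)⟩

lemma RS_rev (O : Finset (Fin n)) (x y : Fin n) (h : (RS O).r x y) : (RS O).r x.rev y.rev := by
  refine ⟨by rw [NN_symm, NN_symm]; exact h.1, fun z hz => ?_⟩
  rw [NN_symm, ← EE_symm O z (by have := x.rev.isLt; have := y.rev.isLt; omega)]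
  rw [Fin.val_rev, Fin.val_rev] at hz
  exact h.2 _ (by omega)

def Valid (O : Finset (Fin n)) : Prop := ∀ x : Fin n, 1 ≤ NN O x.val

noncomputable def mins (P : Setoid (Fin n)) : Finset (Fin n) := by
  classical exact Finset.univ.filter (fun x => ∀ y, P.r x y → x ≤ y)

lemma mem_mins (P : Setoid (Fin n)) (x : Fin n) : x ∈ mins P ↔ ∀ y, P.r x y → x ≤ y := by
  simp [mins]

lemma mins_RS (O : Finset (Fin n)) (hO : Valid O) : mins (RS O) = O := by
  ext x
  rw [mem_mins]
  constructor
  · intro h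
    by_contra hx
    have hN : NN O x.val = EE O x.val := by rw [NN_eq]; simp [hx]
    have h1 := hO x
    -- greatest y < x with EE y < NN x
    have key : ∀ k : ℕ, k ≤ x.val → (∀ z : ℕ, k ≤ z ∧ z ≤ x.val → NN O x.val ≤ EE O z) → False := by
      intro k
      induction k with
      | zero =>
        intro _ hz
        have := hz 0 (by omega)
        rw [EE_zero] at this; omega
      | succ k ih =>
        intro hk hz
        by_cases hc : NN O x.val ≤ EE O k
        · refine ih (by omega) (fun z hz' => ?_)
          rcases Nat.eq_or_lt_of_le hz'.1 with e | e
          · rw [← e]; exact hc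
          · exact hz z (by omega)
        · let y : Fin n := ⟨k, by omega⟩
          have e1 := NN_eq O y
          have e2 := EE_succ O y
          have e3 := hz (k + 1) (by omega)
          simp only [y] at e1 e2
          have e4 : NN O x.val = NN O k := by
            split_ifs at e1 e2 <;> omega
          have := h y ⟨e4, fun z hz' => hz z (by simp only [y] at hz'; omega)⟩
          rw [Fin.le_def] at this
          simp only [y] at this; omega
    exact key x.val le_rfl (fun z hz => by rw [show z = x.val by omega]; omega)
  · intro hx y hy
    by_contra hlt
    rw [Fin.le_def] at hlt
    have h1 := hy.2 x.val (by omega)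
    have h2 := NN_eq O x
    rw [if_pos hx] at h2
    omega

section forward
variable (P : Setoid (Fin n))

open Classical in
noncomputable def mx (x : Fin n) : Fin n :=
  (Finset.univ.filter (fun y => P.r x y)).max' ⟨x, by simp⟩

lemma mx_rel (x : Fin n) : P.r x (mx P x) := by
  classical
  have := Finset.max'_mem (Finset.univ.filter (fun y => P.r x y)) ⟨x, by simp⟩
  rw [Finset.mem_filter] at this
  unfold mx; convert this.2

lemma le_mx {x y : Fin n} (h : P.r x y) : y ≤ mx P x := by
  classical
  unfold mx
  exact Finset.le_max' _ _ (by simpa using h)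

open Classical in
noncomputable def mn (x : Fin n) : Fin n :=
  (Finset.univ.filter (fun y => P.r x y)).min' ⟨x, by simp⟩

lemma mn_rel (x : Fin n) : P.r x (mn P x) := by
  classical
  have := Finset.min'_mem (Finset.univ.filter (fun y => P.r x y)) ⟨x, by simp⟩
  rw [Finset.mem_filter] at this
  unfold mn; convert this.2

lemma mn_le {x y : Fin n} (h : P.r x y) : mn P x ≤ y := by
  classical
  unfold mn
  exact Finset.min'_le _ _ (by simpa using h)

lemma mn_mem (x : Fin n) : mn P x ∈ mins P := by
  rw [mem_mins]; intro y hy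
  exact mn_le P (P.trans' (mn_rel P x) hy)

lemma mins_eq {a b : Fin n} (ha : a ∈ mins P) (hb : b ∈ mins P) (h : P.r a b) : a = b := by
  rw [mem_mins] at ha hb
  exact le_antisymm (ha _ h) (hb _ (P.symm' h))

lemma card_big (hrev : ∀ x y, P.r x y → P.r x.rev y.rev) (x : ℕ) (hx : x ≤ n) :
    ((mins P).filter (fun o => n - x ≤ o.val)).card =
      ((mins P).filter (fun o => (mx P o).val < x)).card := by
  have hmem : ∀ o, (mx P o).rev ∈ mins P := by
    intro o
    rw [mem_mins]; intro y hy
    have h1 := hrev _ _ hy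
    rw [Fin.rev_rev] at h1
    have := le_mx P (P.trans' (mx_rel P o) h1)
    exact Fin.rev_le_iff.mpr this |>.trans_eq rfl
  have hinv : ∀ o ∈ mins P, (mx P (mx P o).rev).rev = o := by
    intro o ho
    refine mins_eq P (hmem _) ho ?_
    have h1 := hrev _ _ (mx_rel P (mx P o).rev)
    rw [Fin.rev_rev] at h1
    exact P.symm' (P.trans' (mx_rel P o) h1)
  refine Finset.card_nbij' (fun o => (mx P o).rev) (fun o => (mx P o).rev) ?_ ?_ ?_ ?_
  · intro o ho
    simp only [Finset.coe_filter, Set.mem_ofPred_eq] at ho ⊢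
    refine ⟨hmem _, ?_⟩
    have := congrArg Fin.val (hinv o ho.1)
    rw [Fin.val_rev] at this
    omega
  · intro o ho
    simp only [Finset.coe_filter, Set.mem_ofPred_eq] at ho ⊢
    refine ⟨hmem _, ?_⟩
    rw [Fin.val_rev]; omega
  · intro o ho
    simp only [Finset.coe_filter, Set.mem_ofPred_eq] at ho
    exact hinv o ho.1
  · intro o ho
    simp only [Finset.coe_filter, Set.mem_ofPred_eq] at ho
    exact hinv o ho.1

lemma cover_gen (hrev : ∀ x y, P.r x y → P.r x.rev y.rev) (w x : ℕ) (hx : x ≤ n) (hw : x ≤ w) :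
    A (mins P) w + A (mins P) (n - x) - (mins P).card =
      (((mins P).filter (fun o => o.val < w ∧ x ≤ (mx P o).val)).card : ℤ) := by
  have h1 := card_big P hrev x hx
  have h2 := Finset.card_filter_add_card_filter_not (s := mins P) (fun o => o.val < n - x)
  have h3 : ((mins P).filter (fun o => ¬ o.val < n - x)) =
      (mins P).filter (fun o => n - x ≤ o.val) := by
    ext; simp
  have h4 := Finset.card_filter_add_card_filter_not (s := (mins P).filter (fun o => o.val < w))
    (fun o => x ≤ (mx P o).val)
  rw [Finset.filter_filter, Finset.filter_filter] at h4
  have h5 : (mins P).filter (fun o => o.val < w ∧ ¬ x ≤ (mx P o).val) =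
      (mins P).filter (fun o => (mx P o).val < x) := by
    ext o
    simp only [Finset.mem_filter]
    have := Fin.le_def.mp (le_mx P (P.refl' o))
    constructor
    · rintro ⟨a, b, c⟩; exact ⟨a, by omega⟩
    · rintro ⟨a, b⟩; exact ⟨a, by omega, by omega⟩
  rw [h3] at h2
  rw [h5] at h4
  unfold A
  omega

lemma EE_cover (hrev : ∀ x y, P.r x y → P.r x.rev y.rev) (x : ℕ) (hx : x ≤ n) :
    EE (mins P) x = (((mins P).filter (fun o => o.val < x ∧ x ≤ (mx P o).val)).card : ℤ) :=
  cover_gen P hrev x x hx le_rfl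

lemma NN_cover (hrev : ∀ x y, P.r x y → P.r x.rev y.rev) (x : Fin n) :
    NN (mins P) x.val =
      (((mins P).filter (fun o => o ≤ x ∧ x ≤ mx P o)).card : ℤ) := by
  have := cover_gen P hrev (x.val + 1) x.val x.isLt.le (by omega)
  unfold NN
  rw [this]
  congr 2
  ext o; simp only [Finset.mem_filter, Fin.le_def, Nat.lt_succ_iff]

lemma mins_valid (hrev : ∀ x y, P.r x y → P.r x.rev y.rev) : Valid (mins P) := by
  intro x
  rw [NN_cover P hrev]
  have : 0 < ((mins P).filter (fun o => o ≤ x ∧ x ≤ mx P o)).card := by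
    rw [Finset.card_pos]
    refine ⟨mn P x, ?_⟩
    rw [Finset.mem_filter]
    exact ⟨mn_mem P x, mn_le P (P.refl' x), le_mx P (P.symm' (mn_rel P x))⟩
  omega

lemma rel_of_P (hP : FNC P) (hrev : ∀ x y, P.r x y → P.r x.rev y.rev) {x y : Fin n}
    (hxy : x ≤ y) (h : P.r x y) : Rel (mins P) x y := by
  -- blocks covering a point of the pair cover everything in between
  have hx : ∀ o ∈ mins P, o ≤ x → x ≤ mx P o → y ≤ mx P o := by
    intro o ho h1 h2
    by_cases hr : P.r o x
    · exact le_mx P (P.trans' hr h)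
    by_contra hlt
    push Not at hlt
    have h1' : o < x := lt_of_le_of_ne h1 (fun e => hr (e ▸ P.refl' _))
    have h2' : x < mx P o := lt_of_le_of_ne h2 (fun e => hr (e ▸ mx_rel P o))
    exact hr (hP o x (mx P o) y h1' h2' hlt (mx_rel P o) h)
  have hy : ∀ o ∈ mins P, o ≤ y → y ≤ mx P o → o ≤ x := by
    intro o ho h1 h2
    by_cases hr : P.r o x
    · exact (mem_mins P o).mp ho x hr
    by_contra hlt
    push Not at hlt
    have hr' : ¬ P.r o y := fun e => hr (P.trans' e (P.symm' h))
    have h1' : o < y := lt_of_le_of_ne h1 (fun e => hr' (e ▸ P.refl' _))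
    have h2' : y < mx P o := lt_of_le_of_ne h2 (fun e => hr' (e ▸ mx_rel P o))
    exact hr (P.symm' (hP x o y (mx P o) hlt h1' h2' h (mx_rel P o)))
  refine ⟨?_, ?_⟩
  · rw [NN_cover P hrev, NN_cover P hrev]
    congr 2
    ext o; simp only [Finset.mem_filter]
    constructor
    · rintro ⟨a, b, c⟩; exact ⟨a, b.trans hxy, hx o a b c⟩
    · rintro ⟨a, b, c⟩; exact ⟨a, hy o a b c, hxy.trans c⟩
  · intro z hz
    rw [Fin.le_def] at hxy
    rw [NN_cover P hrev, EE_cover P hrev z (by omega)]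
    have : ((mins P).filter (fun o => o ≤ x ∧ x ≤ mx P o)) ⊆
        ((mins P).filter (fun o => o.val < z ∧ z ≤ (mx P o).val)) := by
      intro o; simp only [Finset.mem_filter]
      rintro ⟨a, b, c⟩
      have := hx o a b c
      rw [Fin.le_def] at this b
      exact ⟨a, by omega, by omega⟩
    exact_mod_cast Finset.card_le_card this

lemma P_of_rel (hP : FNC P) (hrev : ∀ x y, P.r x y → P.r x.rev y.rev) {x y : Fin n}
    (hxy : x ≤ y) (h : Rel (mins P) x y) : P.r x y := by
  obtain ⟨h1, h2⟩ := h
  have hmx : y ≤ mx P x := by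
    by_contra hlt
    push Not at hlt
    have hxm := le_mx P (P.refl' x)
    have h3 := h2 ((mx P x).val + 1) (by rw [Fin.lt_def] at hlt; rw [Fin.le_def] at hxm; omega)
    rw [NN_cover P hrev, EE_cover P hrev _ (by omega)] at h3
    have : ((mins P).filter (fun o => o.val < (mx P x).val + 1 ∧ (mx P x).val + 1 ≤ (mx P o).val)) ⊂
        ((mins P).filter (fun o => o ≤ x ∧ x ≤ mx P o)) := by
      rw [Finset.ssubset_iff_of_subset]
      · refine ⟨mn P x, ?_, ?_⟩
        · rw [Finset.mem_filter]
          exact ⟨mn_mem P x, mn_le P (P.refl' x), le_mx P (P.symm' (mn_rel P x))⟩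
        · rw [Finset.mem_filter]
          rintro ⟨-, -, h⟩
          have := Fin.le_def.mp (le_mx P (P.trans' (mn_rel P x) (mx_rel P (mn P x))))
          omega
      · intro o
        simp only [Finset.mem_filter]
        rintro ⟨a, b, c⟩
        have c' : mx P x < mx P o := by rw [Fin.lt_def]; omega
        refine ⟨a, ?_, hxm.trans c'.le⟩
        by_contra hox
        push Not at hox
        have hnr : ¬ P.r x o := fun e => by
          have := le_mx P (P.trans' e (mx_rel P o))
          exact absurd this (not_le.mpr c')
        have b' : o < mx P x := by
          refine lt_of_le_of_ne (by rw [Fin.le_def]; omega) ?_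
          intro e; exact hnr (e ▸ mx_rel P x)
        exact hnr (hP x o (mx P x) (mx P o) hox b' c' (mx_rel P x) (mx_rel P o))
    have := Finset.card_lt_card this
    omega
  have hmn : mn P y ≤ x := by
    by_contra hlt
    push Not at hlt
    have hym := mn_le P (P.refl' y)
    have h3 := h2 ((mn P y).val) (by rw [Fin.lt_def] at hlt; rw [Fin.le_def] at hym; omega)
    rw [h1, NN_cover P hrev, EE_cover P hrev _ (by omega)] at h3
    have : ((mins P).filter (fun o => o.val < (mn P y).val ∧ (mn P y).val ≤ (mx P o).val)) ⊂
        ((mins P).filter (fun o => o ≤ y ∧ y ≤ mx P o)) := by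
      rw [Finset.ssubset_iff_of_subset]
      · refine ⟨mn P y, ?_, ?_⟩
        · rw [Finset.mem_filter]
          exact ⟨mn_mem P y, mn_le P (P.refl' y), le_mx P (P.symm' (mn_rel P y))⟩
        · rw [Finset.mem_filter]
          rintro ⟨-, h, -⟩
          omega
      · intro o
        simp only [Finset.mem_filter]
        rintro ⟨a, b, c⟩
        have b' : o < mn P y := by rw [Fin.lt_def]; omega
        refine ⟨a, b'.le.trans hym, ?_⟩
        by_contra hox
        push Not at hox
        have hnr : ¬ P.r y o := fun e => by
          have := mn_le P e
          exact absurd this (not_le.mpr b')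
        have c' : mn P y < mx P o := by
          refine lt_of_le_of_ne (by rw [Fin.le_def]; omega) ?_
          intro e; exact hnr (P.trans' (mn_rel P y) (e ▸ P.symm' (mx_rel P o)))
        have := hP o (mn P y) (mx P o) y b' c' hox (mx_rel P o) (P.symm' (mn_rel P y))
        exact hnr (P.trans' (mn_rel P y) (P.symm' this))
    have := Finset.card_lt_card this
    omega
  by_contra hnr
  have h3 : mn P y < x := lt_of_le_of_ne hmn
    (fun e => hnr (e ▸ P.symm' (mn_rel P y)))
  have h4 : x < y := lt_of_le_of_ne hxy (fun e => hnr (e ▸ P.refl' _))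
  have h5 : y < mx P x := lt_of_le_of_ne hmx (fun e => hnr (e ▸ mx_rel P x))
  have := hP _ _ _ _ h3 h4 h5 (P.symm' (mn_rel P y)) (mx_rel P x)
  exact hnr (P.symm' (P.trans' (mn_rel P y) this))

lemma RS_mins (hP : FNC P) (hrev : ∀ x y, P.r x y → P.r x.rev y.rev) : RS (mins P) = P := by
  ext x y
  rcases le_total x y with h | h
  · exact ⟨P_of_rel P hP hrev h, rel_of_P P hP hrev h⟩
  · constructor
    · intro e; exact P.symm' (P_of_rel P hP hrev h ((RS _).symm' e))
    · intro e; exact (RS _).symm' (rel_of_P P hP hrev h (P.symm' e))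

end forward

noncomputable def symEquiv (n : ℕ) :
    {P : Setoid (Fin n) // FNC P ∧ ∀ x y, P.r x y → P.r x.rev y.rev} ≃
      {O : Finset (Fin n) // Valid O} where
  toFun P := ⟨mins P.1, mins_valid P.1 P.2.2⟩
  invFun O := ⟨RS O.1, RS_fnc O.1, RS_rev O.1⟩
  left_inv P := Subtype.ext (RS_mins P.1 P.2.1 P.2.2)
  right_inv O := Subtype.ext (mins_RS O.1 O.2)

end Stat

namespace Cnt

def f : ℕ → ℕ → ℕ
  | 0, _ => 1
  | n + 1, 0 => f n 0 + f n 1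
  | n + 1, d + 1 => 2 * f n (d + 1) + f n (d + 2) + f n d

lemma ch (n k : ℕ) : (2 * (n + 1)).choose (k + 2) =
    (2 * n).choose k + 2 * (2 * n).choose (k + 1) + (2 * n).choose (k + 2) := by
  rw [show 2 * (n + 1) = 2 * n + 1 + 1 by ring, Nat.choose_succ_succ, Nat.choose_succ_succ,
    Nat.choose_succ_succ]
  ring

lemma f_eq (n : ℕ) : f n 0 = (2 * n).choose n ∧
    ∀ d, f n (d + 1) = f n d + 2 * (2 * n).choose (n + d + 1) := by
  induction n with
  | zero => simp [f]
  | succ n ih =>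
    obtain ⟨h0, h1⟩ := ih
    constructor
    · have := h1 0
      rw [f, this, h0]
      cases n with
      | zero => simp
      | succ n =>
        rw [show n + 1 + 1 = n + 2 by ring, show n + 1 + 0 + 1 = n + 2 by ring,
          show 2 * (n + 2) = 2 * ((n + 1) + 1) by ring, ch (n + 1) n]
        have : (2 * (n + 1)).choose (n + 2) = (2 * (n + 1)).choose n := by
          apply Nat.choose_symm_of_eq_add; ring
        rw [this]; ring
    · intro d
      rw [show n + 1 + d + 1 = (n + d) + 2 by ring, ch]
      cases d with
      | zero =>
        have e1 := h1 0
        have e2 := h1 1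
        simp only [f, Nat.add_zero, Nat.zero_add, Nat.reduceAdd] at *
        rw [show n + 1 + 1 = n + 2 by ring] at e2
        omega
      | succ d =>
        have e1 := h1 d
        have e2 := h1 (d + 1)
        have e3 := h1 (d + 2)
        simp only [f, Nat.add_assoc, Nat.reduceAdd] at *
        rw [show n + (d + 1 + 2) = n + (d + 3) by ring, show n + (d + 1 + 1) = n + (d + 2) by ring]
          at *
        omega

def VW : (n : ℕ) → ℕ → (Fin n → Bool × Bool) → Prop
  | 0, _, _ => True
  | n + 1, d, w => 1 ≤ d + (w 0).1.toNat ∧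
      VW n (d + (w 0).1.toNat - (w 0).2.toNat) (Fin.tail w)

def consE (n d : ℕ) : {w // VW (n + 1) d w} ≃
    Σ a : Bool × Bool, {w : Fin n → Bool × Bool // 1 ≤ d + a.1.toNat ∧
      VW n (d + a.1.toNat - a.2.toNat) w} where
  toFun w := ⟨w.1 0, ⟨Fin.tail w.1, w.2⟩⟩
  invFun p := ⟨Fin.cons p.1 p.2.1, by
    have := p.2.2
    simpa [VW] using this⟩
  left_inv w := by simp
  right_inv p := by
    obtain ⟨a, w, hw⟩ := p
    rfl

lemma card_VW (n d : ℕ) : Nat.card {w // VW n d w} = f n d := by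
  induction n generalizing d with
  | zero =>
    simp [VW, f]
  | succ n ih =>
    rw [Nat.card_congr (consE n d), Nat.card_sigma, Fintype.sum_prod_type]
    simp only [Fintype.univ_bool, Finset.mem_singleton, Bool.true_eq_false, not_false_eq_true,
      Finset.sum_insert, Finset.sum_singleton, Bool.toNat_true, Bool.toNat_false]
    cases d with
    | zero =>
      simp [f, ih]
    | succ d =>
      simp [f, ih]
      ring

lemma VW_iff (n d : ℕ) (w : Fin n → Bool × Bool) (e : ℕ → ℤ) (h0 : e 0 = d)
    (he : ∀ i : Fin n, e (i.val + 1) = e i.val + (w i).1.toNat - (w i).2.toNat) :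
    VW n d w ↔ ∀ i : Fin n, 1 ≤ e i.val + (w i).1.toNat := by
  induction n generalizing d e with
  | zero => simp [VW]
  | succ n ih =>
    rw [VW, Fin.forall_fin_succ]
    have h1 : (1 ≤ d + (w 0).1.toNat) ↔ 1 ≤ e (0 : Fin (n + 1)).val + (w 0).1.toNat := by
      simp only [Fin.val_zero, h0]; omega
    rw [← h1]
    refine and_congr_right (fun h => ?_)
    have hh := he 0
    simp only [Fin.val_zero, h0, Nat.zero_add] at hh
    rw [ih _ (Fin.tail w) (fun i => e (i + 1))]
    · simp [Fin.tail]
    · simp only [Nat.zero_add]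
      rw [hh]
      have : (w 0).2.toNat ≤ 1 := Bool.toNat_le _
      omega
    · intro i
      have := he i.succ
      simpa [Fin.tail] using this

open Stat

def wordE (m : ℕ) : Finset (Fin (2 * m)) ≃ (Fin m → Bool × Bool) where
  toFun O i := (decide (Fin.castLE (by omega) i ∈ O), decide ((Fin.castLE (by omega) i).rev ∈ O))
  invFun w := Finset.univ.filter (fun j =>
    if h : j.val < m then (w ⟨j.val, h⟩).1 = true
    else (w ⟨j.rev.val, by rw [Fin.val_rev]; omega⟩).2 = true)
  left_inv O := by
    ext j
    simp only [decide_eq_true_eq, Finset.mem_filter, Finset.mem_univ, true_and]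
    split_ifs with h
    · rfl
    · have : (Fin.castLE (show m ≤ 2 * m by omega)
        ⟨j.rev.val, by rw [Fin.val_rev]; omega⟩ : Fin (2 * m)) = j.rev := rfl
      rw [this, Fin.rev_rev]
  right_inv w := by
    funext i
    have h1 := i.isLt
    have h2 : ¬ 2 * m - (i.val + 1) < m := by omega
    ext
    · simp [h1]
    · simp only [Fin.val_rev, Fin.val_castLE, Finset.mem_filter, Finset.mem_univ, true_and, h2,
        dite_false, Bool.decide_eq_true]
      congr 2
      apply Fin.ext
      change 2 * m - (2 * m - (i.val + 1) + 1) = i.val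
      omega

lemma card_valid (m : ℕ) : Nat.card {O : Finset (Fin (2 * m)) // Valid O} = (2 * m).choose m := by
  rw [← (f_eq m).1, ← card_VW]
  refine Nat.card_congr ((wordE m).subtypeEquiv (fun O => ?_))
  have hle : m ≤ 2 * m := by omega
  have hw : ∀ i : Fin m, NN O i.val = EE O i.val + ((wordE m O i).1.toNat : ℤ) := by
    intro i
    have := NN_eq O (Fin.castLE hle i)
    rw [Fin.val_castLE] at this
    rw [this]
    congr 1
    simp only [wordE, Equiv.coe_fn_mk]
    split_ifs with h <;> simp [h]
  rw [VW_iff m 0 _ (EE O)]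
  · constructor
    · intro h i
      rw [← hw]; exact h (Fin.castLE hle i)
    · intro h x
      by_cases hx : x.val < m
      · have := h ⟨x.val, hx⟩
        rw [← hw] at this; exact this
      · have := h ⟨x.rev.val, by rw [Fin.val_rev]; omega⟩
        rw [← hw] at this
        rw [← NN_symm]; exact this
  · simp [EE_zero]
  · intro i
    rw [← hw]
    have := EE_succ O (Fin.castLE hle i)
    rw [Fin.val_castLE] at this
    rw [this]
    congr 1
    simp only [wordE, Equiv.coe_fn_mk]
    split_ifs with h <;> simp [h]

end Cnt

namespace Krew

def kr {n : ℕ} (P : Setoid (Fin n)) : Setoid (Fin n) where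
  r u v := ∀ x y, P.r x y → ((x < u ↔ x < v) ↔ (y < u ↔ y < v))
  iseqv := by
    refine ⟨fun x => by intros; simp, fun {u v} h x y hxy => ?_, fun {u v w} h h' x y hxy => ?_⟩
    · have := h x y hxy; tauto
    · have := h x y hxy
      have := h' x y hxy
      tauto

lemma kr_fnc {n : ℕ} (P : Setoid (Fin n)) : FNC (kr P) := by
  intro a b c d hab hbc hcd hac hbd x y hxy
  have h1 := hac x y hxy
  have h2 := hbd x y hxy
  have mono : ∀ z : Fin n, (z < a → z < b) ∧ (z < b → z < c) ∧ (z < c → z < d) := fun z =>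
    ⟨fun h => h.trans hab, fun h => h.trans hbc, fun h => h.trans hcd⟩
  obtain ⟨m1, m2, m3⟩ := mono x
  obtain ⟨m4, m5, m6⟩ := mono y
  revert h1 h2 m1 m2 m3 m4 m5 m6
  generalize (x < a) = p1
  generalize (x < b) = p2
  generalize (x < c) = p3
  generalize (x < d) = p4
  generalize (y < a) = p5
  generalize (y < b) = p6
  generalize (y < c) = p7
  generalize (y < d) = p8
  clear hxy hab hbc hcd hac hbd mono
  intro h1 h2 m1 m2 m3 m4 m5 m6
  by_cases p1 <;> by_cases p2 <;> by_cases p3 <;> by_cases p4 <;> by_cases p5 <;> by_cases p6 <;>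
    by_cases p7 <;> by_cases p8 <;> simp_all

lemma kr_sep {n : ℕ} (P : Setoid (Fin n)) (hP : FNC P) (x y : Fin n) (hxy : x < y)
    (hn : ¬ P.r x y) : ∃ u v, (kr P).r u v ∧ ¬ ((x < u ↔ x < v) ↔ (y < u ↔ y < v)) := by
  classical
  -- b1 is the largest element below y of the block of x
  let S := Finset.univ.filter (fun z => P.r x z ∧ z < y)
  have hS : S.Nonempty := ⟨x, by simp [S, hxy]⟩
  obtain ⟨b1, hb1, hmax⟩ := S.exists_max_image id hS
  simp only [S, Finset.mem_filter, Finset.mem_univ, true_and, id] at hb1 hmax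
  have hxb1 : x ≤ b1 := hmax x ⟨P.refl' x, hxy⟩
  have hby := Fin.lt_def.mp hb1.2
  let u : Fin n := ⟨b1.val + 1, by omega⟩
  have hu : ∀ z : Fin n, z < u ↔ z ≤ b1 := by
    intro z; simp only [u, Fin.lt_def, Fin.le_def]; omega
  by_cases hT : ∃ z, P.r x z ∧ y < z
  · let T := Finset.univ.filter (fun z => P.r x z ∧ y < z)
    have hT' : T.Nonempty := by obtain ⟨z, hz⟩ := hT; exact ⟨z, by simpa [T] using hz⟩
    obtain ⟨b2, hb2, hmin⟩ := T.exists_min_image id hT'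
    simp only [T, Finset.mem_filter, Finset.mem_univ, true_and, id] at hb2 hmin
    have gap : ∀ z, b1 < z → z < b2 → ¬ P.r x z := by
      intro z h1 h2 h3
      rcases lt_trichotomy z y with h | h | h
      · exact absurd (hmax z ⟨h3, h⟩) (not_le.mpr h1)
      · exact hn (h ▸ h3)
      · exact absurd (hmin z ⟨h3, h⟩) (not_le.mpr h2)
    have hb12 : b1 < b2 := hb1.2.trans hb2.2
    have hr12 : P.r b1 b2 := P.trans' (P.symm' hb1.1) hb2.1
    have key : ∀ z z', P.r z z' → (b1 < z ∧ z < b2) → (b1 < z' ∧ z' < b2) := by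
      rintro z z' hz ⟨h1, h2⟩
      have hg := gap z h1 h2
      have hg' : ¬ P.r x z' := fun e => hg (P.trans' e (P.symm' hz))
      by_contra hc
      have hne1 : z' ≠ b1 := fun e => hg' (e ▸ hb1.1)
      have hne2 : z' ≠ b2 := fun e => hg' (e ▸ hb2.1)
      rcases lt_or_ge z' b1 with h | h
      · have := hP z' b1 z b2 h h1 h2 (P.symm' hz) hr12
        exact hg' (P.trans' hb1.1 (P.symm' this))
      · have h' : b2 < z' := by
          have := lt_of_le_of_ne h (Ne.symm hne1)
          by_contra hh
          exact hc ⟨this, lt_of_le_of_ne (not_lt.mp hh) hne2⟩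
        have := hP b1 z b2 z' h1 h2 h' hr12 hz
        exact hg (P.trans' hb1.1 this)
    have hd : ∀ z : Fin n, (z < u ↔ z < b2) ↔ ¬ (b1 < z ∧ z < b2) := by
      intro z; rw [hu, Fin.le_def, Fin.lt_def, Fin.lt_def]
      rw [Fin.lt_def] at hb12
      omega
    refine ⟨u, b2, ?_, ?_⟩
    · intro z z' hz
      rw [hd, hd]
      exact not_congr ⟨key z z' hz, key z' z (P.symm' hz)⟩
    · rw [hd, hd]
      have h1 : ¬ (b1 < x ∧ x < b2) := fun h => absurd hxb1 (not_le.mpr h.1)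
      have h2 : b1 < y ∧ y < b2 := ⟨hb1.2, hb2.2⟩
      tauto
  · push Not at hT
    let T := Finset.univ.filter (fun z => P.r x z)
    obtain ⟨b0, hb0, hmin⟩ := T.exists_min_image id ⟨x, by simp [T]⟩
    simp only [T, Finset.mem_filter, Finset.mem_univ, true_and, id] at hb0 hmin
    have hle : ∀ z, P.r x z → z ≤ b1 := by
      intro z hz
      have h1 := hT z hz
      have h2 : z ≠ y := fun e => hn (e ▸ hz)
      exact hmax z ⟨hz, lt_of_le_of_ne h1 h2⟩
    have hb01 : b0 ≤ b1 := hmin b1 hb1.1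
    have hr01 : P.r b0 b1 := P.trans' (P.symm' hb0) hb1.1
    have key : ∀ z z', P.r z z' → (b0 ≤ z ∧ z ≤ b1) → (b0 ≤ z' ∧ z' ≤ b1) := by
      rintro z z' hz ⟨h1, h2⟩
      by_cases hg : P.r x z
      · have := P.trans' hg hz
        exact ⟨hmin _ this, hle _ this⟩
      have hg' : ¬ P.r x z' := fun e => hg (P.trans' e (P.symm' hz))
      have h1' : b0 < z := lt_of_le_of_ne h1 (fun e => hg (e ▸ hb0))
      have h2' : z < b1 := lt_of_le_of_ne h2 (fun e => hg (e ▸ hb1.1))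
      constructor
      · by_contra h
        have := hP z' b0 z b1 (not_le.mp h) h1' h2' (P.symm' hz) hr01
        exact hg' (P.trans' hb0 (P.symm' this))
      · by_contra h
        have := hP b0 z b1 z' h1' h2' (not_le.mp h) hr01 hz
        exact hg (P.trans' hb0 this)
    have hd : ∀ z : Fin n, (z < u ↔ z < b0) ↔ ¬ (b0 ≤ z ∧ z ≤ b1) := by
      intro z; rw [hu, Fin.le_def, Fin.lt_def, Fin.le_def]
      rw [Fin.le_def] at hb01
      omega
    refine ⟨u, b0, ?_, ?_⟩
    · intro z z' hz
      rw [hd, hd]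
      exact not_congr ⟨key z z' hz, key z' z (P.symm' hz)⟩
    · rw [hd, hd]
      have h1 : (b0 ≤ x ∧ x ≤ b1) := ⟨hmin x (P.refl' x), hxb1⟩
      have h2 : ¬ (b0 ≤ y ∧ y ≤ b1) := fun h => absurd h.2 (not_le.mpr hb1.2)
      tauto

lemma kr_iff {n : ℕ} (P : Setoid (Fin n)) (hP : FNC P) (x y : Fin n) :
    P.r x y ↔ ∀ u v, (kr P).r u v → ((x < u ↔ x < v) ↔ (y < u ↔ y < v)) := by
  constructor
  · intro h u v huv; exact huv x y h
  · intro h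
    by_contra hn
    rcases lt_trichotomy x y with hl | hl | hl
    · obtain ⟨u, v, h1, h2⟩ := kr_sep P hP x y hl hn
      exact h2 (h u v h1)
    · exact hn (hl ▸ P.refl' x)
    · obtain ⟨u, v, h1, h2⟩ := kr_sep P hP y x hl (fun e => hn (P.symm' e))
      exact h2 (h u v h1).symm

lemma kr_inj {n : ℕ} (P Q : Setoid (Fin n)) (hP : FNC P) (hQ : FNC Q) (h : kr P = kr Q) :
    P = Q := by
  ext x y
  have h1 := kr_iff P hP x y
  have h2 := kr_iff Q hQ x y
  rw [h] at h1
  exact h1.trans h2.symm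

lemma val_sub' {k : ℕ} (s x : Fin (k + 1)) :
    (s - x).val = if x.val ≤ s.val then s.val - x.val else s.val + (k + 1) - x.val := by
  rw [Fin.sub_def]
  simp only
  have := s.isLt
  have := x.isLt
  split_ifs with h
  · rw [show k + 1 - x.val + s.val = (s.val - x.val) + (k + 1) by omega, Nat.add_mod_right,
      Nat.mod_eq_of_lt (by omega)]
  · rw [Nat.mod_eq_of_lt (by omega)]; omega

lemma val_add_one' {k : ℕ} (s : Fin (k + 1)) :
    (s + 1).val = if s.val = k then 0 else s.val + 1 := by
  rw [Fin.val_add_one]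
  simp only [Fin.ext_iff, Fin.val_last]

lemma refl_lt {k : ℕ} (s : Fin (k + 1)) : ∃ c d : Fin (k + 1) → Prop, ∀ x u,
    (s - x < s + 1 - u) ↔ ((x < u) ↔ (c u ↔ d x)) := by
  refine ⟨fun u => ¬ (u.val > s.val + 1 ∨ s.val = k ∧ u.val = 0), fun x => x.val > s.val, ?_⟩
  intro x u
  rw [Fin.lt_def, Fin.lt_def, val_sub', val_sub', val_add_one']
  have := s.isLt
  have := x.isLt
  have := u.isLt
  split_ifs <;> omega

lemma kr_refl {k : ℕ} (P : Setoid (Fin (k + 1))) (s : Fin (k + 1))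
    (h : ∀ x y, P.r x y → P.r (s - x) (s - y)) (u v : Fin (k + 1)) (huv : (kr P).r u v) :
    (kr P).r (s + 1 - u) (s + 1 - v) := by
  obtain ⟨c, d, hcd⟩ := refl_lt s
  intro x y hxy
  have h1 := huv _ _ (h x y hxy)
  have e : ∀ z w, (z < s + 1 - w) ↔ ((s - z < w) ↔ (c w ↔ d (s - z))) := by
    intro z w
    have := hcd (s - z) w
    rwa [sub_sub_cancel] at this
  rw [e, e, e, e]
  revert h1
  generalize (s - x < u) = p1
  generalize (s - x < v) = p2
  generalize (s - y < u) = p3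
  generalize (s - y < v) = p4
  generalize c u = p5
  generalize c v = p6
  generalize d (s - x) = p7
  generalize d (s - y) = p8
  intro h1
  by_cases p1 <;> by_cases p2 <;> by_cases p3 <;> by_cases p4 <;> by_cases p5 <;> by_cases p6 <;>
    by_cases p7 <;> by_cases p8 <;> simp_all

def Fixd (k : ℕ) (s : Fin (k + 1)) :=
  {P : Setoid (Fin (k + 1)) // FNC P ∧ ∀ x y, P.r x y → P.r (s - x) (s - y)}

instance {α : Type*} [Finite α] : Finite (Setoid α) :=
  Finite.of_injective (fun P : Setoid α => P.r) (fun P Q h => by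
    ext x y; exact iff_of_eq (congrFun (congrFun h x) y))

instance (k : ℕ) (s : Fin (k + 1)) : Finite (Fixd k s) := by unfold Fixd; infer_instance

lemma card_le (k : ℕ) (s : Fin (k + 1)) : Nat.card (Fixd k s) ≤ Nat.card (Fixd k (s + 1)) := by
  refine Nat.card_le_card_of_injective
    (fun P => (⟨kr P.1, kr_fnc P.1, kr_refl P.1 s P.2.2⟩ : Fixd k (s + 1))) ?_
  intro P Q h
  exact Subtype.ext (kr_inj _ _ P.2.1 Q.2.1 (congrArg Subtype.val h))

open Fin.NatCast in
lemma card_le' (k : ℕ) (s : Fin (k + 1)) (j : ℕ) :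
    Nat.card (Fixd k s) ≤ Nat.card (Fixd k (s + (j : Fin (k + 1)))) := by
  induction j with
  | zero => simp
  | succ j ih =>
    refine ih.trans ((card_le k _).trans_eq ?_)
    push_cast
    rw [add_assoc]

open Fin.NatCast in
lemma card_le'' (k : ℕ) (s t : Fin (k + 1)) : Nat.card (Fixd k s) ≤ Nat.card (Fixd k t) := by
  have := card_le' k s (t - s).val
  rwa [Fin.cast_val_eq_self, add_sub_cancel] at this

lemma card_Fixd (m k : ℕ) (hk : k + 1 = 2 * m) (s : Fin (k + 1)) :
    Nat.card (Fixd k s) = (2 * m).choose m := by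
  rw [le_antisymm (card_le'' k s (Fin.last k)) (card_le'' k _ s), ← Cnt.card_valid]
  have hrev : ∀ x : Fin (k + 1), Fin.last k - x = x.rev := by
    intro x; exact Fin.last_sub x
  unfold Fixd
  simp only [hrev]
  have := Nat.card_congr (Stat.symEquiv (k + 1))
  rw [this, hk]

end Krew

namespace Fin4

lemma cyc_shift (L : ℕ) (s a b c d : ZMod L) (h : CycOrd L a b c d) :
    CycOrd L (a + s) (b + s) (c + s) (d + s) := by
  obtain ⟨t, h⟩ := h
  refine ⟨t + s, ?_⟩
  simpa only [add_sub_add_right_eq_sub] using h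

lemma val_neg_one_sub (k : ℕ) (x : ZMod (k + 1)) : (-1 - x : ZMod (k + 1)).val = k - x.val := by
  have h := x.val_lt
  have : ((-1 - x : ZMod (k + 1))) = ((k - x.val : ℕ) : ZMod (k + 1)) := by
    rw [Nat.cast_sub (by omega), ZMod.natCast_zmod_val]
    have : ((k + 1 : ℕ) : ZMod (k + 1)) = 0 := ZMod.natCast_self _
    push_cast at this
    linear_combination -this
  rw [this, ZMod.val_natCast, Nat.mod_eq_of_lt (by omega)]

lemma cyc_refl (k : ℕ) (s a b c d : ZMod (k + 1)) (h : CycOrd (k + 1) a b c d) :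
    CycOrd (k + 1) (s - d) (s - c) (s - b) (s - a) := by
  obtain ⟨t, h⟩ := h
  refine ⟨s + 1 - t, ?_⟩
  have e : ∀ x : ZMod (k + 1), (s - x - (s + 1 - t)).val = k - (x - t).val := by
    intro x; rw [← val_neg_one_sub]; congr 1; ring
  simp only [e]
  have := (a - t).val_lt
  have := (b - t).val_lt
  have := (c - t).val_lt
  have := (d - t).val_lt
  omega

lemma nc_shift (L : ℕ) (P : Setoid (ZMod L)) (hP : IsNC L P) (s : ZMod L) :
    IsNC L (P.comap (fun x => x + s)) := by
  rintro ⟨a, b, c, d, h, h1, h2, h3⟩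
  exact hP ⟨_, _, _, _, cyc_shift L s a b c d h, h1, h2, h3⟩

lemma nc_refl (k : ℕ) (P : Setoid (ZMod (k + 1))) (hP : IsNC (k + 1) P) (s : ZMod (k + 1)) :
    IsNC (k + 1) (P.comap (fun x => s - x)) := by
  rintro ⟨a, b, c, d, h, h1, h2, h3⟩
  refine hP ⟨_, _, _, _, cyc_refl k s a b c d h, P.symm' h2, P.symm' h1, fun h4 => h3 ?_⟩
  have h4' : P.r (s - d) (s - c) := h4
  have h1' : P.r (s - a) (s - c) := h1
  have h2' : P.r (s - b) (s - d) := h2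
  exact P.trans' h1' (P.symm' (P.trans' h2' h4'))

lemma isNC_iff (k : ℕ) (P : Setoid (ZMod (k + 1))) :
    IsNC (k + 1) P ↔ @FNC (k + 1) P := by
  constructor
  · intro h
    have H : ∀ a b c d : ZMod (k + 1), a.val < b.val → b.val < c.val → c.val < d.val →
        P.r a c → P.r b d → P.r a b := by
      intro a b c d hab hbc hcd h1 h2
      by_contra h3
      refine h ⟨a, b, c, d, ⟨0, ?_⟩, h1, h2, h3⟩
      rw [sub_zero, sub_zero, sub_zero, sub_zero]
      exact ⟨hab, hbc, hcd⟩
    exact H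
  · rintro h ⟨a, b, c, d, ⟨t, h1, h2, h3⟩, hac, hbd, hn⟩
    have e : ∀ x : ZMod (k + 1), (x - t).val =
        if x.val ≥ t.val then x.val - t.val else x.val + (k + 1) - t.val :=
      fun x => Krew.val_sub' (k := k) x t
    rw [e, e] at h1 h2 h3
    have l1 := a.val_lt
    have l2 := b.val_lt
    have l3 := c.val_lt
    have l4 := d.val_lt
    have l5 := t.val_lt
    have H : ∀ a b c d : ZMod (k + 1), a.val < b.val → b.val < c.val → c.val < d.val →
      P.r a c → P.r b d → P.r a b := h
    have hca := P.symm' hac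
    have hdb := P.symm' hbd
    have cs : (a.val < b.val ∧ b.val < c.val ∧ c.val < d.val) ∨
        (b.val < c.val ∧ c.val < d.val ∧ d.val < a.val) ∨
        (c.val < d.val ∧ d.val < a.val ∧ a.val < b.val) ∨
        (d.val < a.val ∧ a.val < b.val ∧ b.val < c.val) := by
      split_ifs at h1 h2 h3 <;> omega
    rcases cs with ⟨x, y, z⟩ | ⟨x, y, z⟩ | ⟨x, y, z⟩ | ⟨x, y, z⟩
    · exact hn (H _ _ _ _ x y z hac hbd)
    · exact hn (P.trans' hac (P.symm' (H _ _ _ _ x y z hbd hca)))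
    · exact hn (P.trans' hac (P.trans' (H _ _ _ _ x y z hca hdb) hdb))
    · exact hn (P.symm' (P.trans' hbd (H _ _ _ _ x y z hdb hac)))

open DihedralGroup

def act {L : ℕ} : DihedralGroup L → ZMod L → ZMod L
  | r i, x => x + i
  | sr i, x => -i - x

lemma act_mul {L : ℕ} (g h : DihedralGroup L) (x : ZMod L) : act (g * h) x = act g (act h x) := by
  cases g <;> cases h <;> simp only [r_mul_r, r_mul_sr, sr_mul_r, sr_mul_sr, act] <;> ring

lemma act_one {L : ℕ} (x : ZMod L) : act 1 x = x := by
  rw [one_def]; simp [act]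

instance (k : ℕ) : MulAction (DihedralGroup (k + 1)) (NCPart (k + 1)) where
  smul g P := ⟨P.1.comap (act g⁻¹), by
    cases h : g⁻¹ with
    | r i => exact nc_shift _ _ P.2 i
    | sr i => exact nc_refl _ _ P.2 (-i)⟩
  one_smul P := by
    apply Subtype.ext
    ext x y
    change P.1.r (act 1⁻¹ x) (act 1⁻¹ y) ↔ P.1.r x y
    rw [inv_one, act_one, act_one]
  mul_smul g h P := by
    apply Subtype.ext
    ext x y
    change P.1.r (act (g * h)⁻¹ x) (act (g * h)⁻¹ y) ↔
      P.1.r (act h⁻¹ (act g⁻¹ x)) (act h⁻¹ (act g⁻¹ y))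
    rw [mul_inv_rev, act_mul, act_mul]

lemma smul_r (k : ℕ) (g : DihedralGroup (k + 1)) (P : NCPart (k + 1)) (x y : ZMod (k + 1)) :
    (g • P).1.r x y ↔ P.1.r (act g⁻¹ x) (act g⁻¹ y) := Iff.rfl

lemma eq_smul_iff (k : ℕ) (g : DihedralGroup (k + 1)) (P Q : NCPart (k + 1)) :
    g • Q = P ↔ ∀ x y, P.1.r x y ↔ Q.1.r (act g⁻¹ x) (act g⁻¹ y) := by
  constructor
  · rintro rfl x y; rfl
  · intro h
    apply Subtype.ext
    ext x y
    exact (h x y).symm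

def rotHom (L : ℕ) : Multiplicative (ZMod L) →* DihedralGroup L where
  toFun i := r i.toAdd
  map_one' := rfl
  map_mul' i j := by simp [r_mul_r]

instance (k : ℕ) : MulAction (Multiplicative (ZMod (k + 1))) (NCPart (k + 1)) :=
  MulAction.compHom _ (rotHom (k + 1))

instance (L : ℕ) [NeZero L] : Finite (NCPart L) := by unfold NCPart; infer_instance

lemma dih_eq (k : ℕ) : dihRel (k + 1) =
    (MulAction.orbitRel (DihedralGroup (k + 1)) (NCPart (k + 1))).r := by
  funext P Q
  apply propext
  change _ ↔ ∃ g : DihedralGroup (k + 1), g • Q = P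
  constructor
  · rintro ⟨t, h | h⟩
    · refine ⟨(r t)⁻¹, ?_⟩
      rw [eq_smul_iff, inv_inv]; exact h
    · refine ⟨(sr (-t))⁻¹, ?_⟩
      rw [eq_smul_iff, inv_inv]; intro x y
      rw [h]; simp only [act, neg_neg, sub_eq_add_neg, add_comm]
  · rintro ⟨g, h⟩
    rw [eq_smul_iff] at h
    cases hg : g⁻¹ with
    | r i => rw [hg] at h; exact ⟨i, Or.inl h⟩
    | sr i =>
      rw [hg] at h
      refine ⟨-i, Or.inr fun x y => ?_⟩
      rw [h]; simp only [act, sub_eq_add_neg, add_comm]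

lemma rot_eq (k : ℕ) : rotRel (k + 1) =
    (MulAction.orbitRel (Multiplicative (ZMod (k + 1))) (NCPart (k + 1))).r := by
  funext P Q
  apply propext
  change _ ↔ ∃ g : Multiplicative (ZMod (k + 1)), (r g.toAdd : DihedralGroup (k + 1)) • Q = P
  constructor
  · rintro ⟨t, h⟩
    refine ⟨Multiplicative.ofAdd (-t), ?_⟩
    rw [eq_smul_iff, inv_r]
    simpa [act] using h
  · rintro ⟨g, h⟩
    rw [eq_smul_iff, inv_r] at h
    exact ⟨_, h⟩

lemma burnside (G X : Type) [Group G] [MulAction G X] [Fintype G] [Finite X] :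
    ∑ g : G, Nat.card (MulAction.fixedBy X g) =
      Nat.card (Quotient (MulAction.orbitRel G X)) * Nat.card G := by
  classical
  have := Fintype.ofFinite X
  have := Fintype.ofFinite (Quotient (MulAction.orbitRel G X))
  simp only [Nat.card_eq_fintype_card]
  exact MulAction.sum_card_fixedBy_eq_card_orbits_mul_card_group G X

def dihE (L : ℕ) : ZMod L ⊕ ZMod L ≃ DihedralGroup L where
  toFun := Sum.elim r sr
  invFun g := match g with
    | r i => Sum.inl i
    | sr i => Sum.inr i
  left_inv x := by cases x <;> rfl
  right_inv x := by cases x <;> rfl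

lemma fix_sr (k : ℕ) (i : ZMod (k + 1)) :
    Nat.card (MulAction.fixedBy (NCPart (k + 1)) (sr i : DihedralGroup (k + 1))) =
      Nat.card (Krew.Fixd k (-i : ZMod (k + 1))) := by
  refine Nat.card_congr
    { toFun := fun P => ⟨P.1.1, (isNC_iff k P.1.1).mp P.1.2, ?_⟩
      invFun := fun P => ⟨⟨P.1, (isNC_iff k P.1).mpr P.2.1⟩, ?_⟩
      left_inv := fun P => rfl
      right_inv := fun P => rfl }
  · have h := P.2
    rw [MulAction.mem_fixedBy, eq_smul_iff, inv_sr] at h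
    intro x y hxy
    exact (h x y).mp hxy
  · have h : ∀ x y : ZMod (k + 1), P.1.r x y → P.1.r (-i - x) (-i - y) := P.2.2
    refine MulAction.mem_fixedBy.mpr ((eq_smul_iff k _ _ _).mpr ?_)
    have key : ∀ x y : ZMod (k + 1), P.1.r x y ↔ P.1.r (-i - x) (-i - y) := by
      intro x y
      refine ⟨h x y, fun h' => ?_⟩
      have := h _ _ h'
      rwa [sub_sub_cancel, sub_sub_cancel] at this
    exact key

end Fin4

/-- Even-width case of Theorem 1: `2·N_D(L) − N_C(L) = binom(L, L/2)`. -/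
theorem two_ND_sub_NC_of_even (L : ℕ) (hL : 2 ≤ L) (hLeven : Even L) :
    (2 * N_D L : ℤ) - (N_C L : ℤ) = (Nat.choose L (L / 2) : ℤ) := by
  obtain ⟨m, hm⟩ := hLeven
  obtain ⟨k, rfl⟩ : ∃ k, L = k + 1 := ⟨L - 1, by omega⟩
  have h1 := Fin4.burnside (DihedralGroup (k + 1)) (NCPart (k + 1))
  have h2 := Fin4.burnside (Multiplicative (ZMod (k + 1))) (NCPart (k + 1))
  have hD : N_D (k + 1) = Nat.card (Quotient (MulAction.orbitRel (DihedralGroup (k + 1))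
      (NCPart (k + 1)))) := by
    unfold N_D; rw [Fin4.dih_eq]; rfl
  have hC : N_C (k + 1) = Nat.card (Quotient (MulAction.orbitRel (Multiplicative (ZMod (k + 1)))
      (NCPart (k + 1)))) := by
    unfold N_C; rw [Fin4.rot_eq]; rfl
  rw [← hD, DihedralGroup.nat_card, ← (Fin4.dihE (k + 1)).sum_comp, Fintype.sum_sum_type] at h1
  have h3 : Nat.card (Multiplicative (ZMod (k + 1))) = k + 1 := by
    rw [Nat.card_congr Multiplicative.toAdd, Nat.card_zmod]
  rw [← hC, h3] at h2
  have h4 : ∑ i : ZMod (k + 1), Nat.card (MulAction.fixedBy (NCPart (k + 1))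
      (Fin4.dihE (k + 1) (Sum.inl i))) = N_C (k + 1) * (k + 1) := by
    rw [← h2, ← Multiplicative.toAdd.sum_comp]
    rfl
  have h5 : ∑ i : ZMod (k + 1), Nat.card (MulAction.fixedBy (NCPart (k + 1))
      (Fin4.dihE (k + 1) (Sum.inr i))) = (k + 1) * (k + 1).choose ((k + 1) / 2) := by
    have : ∀ i : ZMod (k + 1), Nat.card (MulAction.fixedBy (NCPart (k + 1))
      (Fin4.dihE (k + 1) (Sum.inr i))) = (k + 1).choose ((k + 1) / 2) := by
      intro i
      have e1 := (Fin4.fix_sr k i).trans (Krew.card_Fixd m k (by omega) _)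
      have e2 : (2 * m).choose m = (k + 1).choose ((k + 1) / 2) := by
        congr 1 <;> omega
      exact e1.trans e2
    rw [Finset.sum_congr rfl (fun i _ => this i), Finset.sum_const, Finset.card_univ, ZMod.card,
      smul_eq_mul]
  rw [h4, h5] at h1
  have h6 : N_C (k + 1) + (k + 1).choose ((k + 1) / 2) = 2 * N_D (k + 1) := by
    apply Nat.eq_of_mul_eq_mul_left (Nat.succ_pos k)
    rw [Nat.succ_eq_add_one]
    linarith
  have h7 : ((N_C (k + 1) : ℤ) + ((k + 1).choose ((k + 1) / 2) : ℕ)) = 2 * (N_D (k + 1) : ℤ) := by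
    exact_mod_cast h6
  linarith
end

section
/- For every odd integer L ≥ 1, the quantity 2·N_D(L) − N_C(L) equals (1/2)·binom(L+1, (L+1)/2). (This is the odd-width case of Theorem 1: 2·N_{Z,sq,PF,L} − N_{Z,tri,PF,L} = (1/2)·N_{Z,sqtri,FP,(L+1)/2} = (1/2)·binom(L+1, (L+1)/2).) -/
open Finset in
/-- Number of up-steps among the first `t` steps. -/
def upc (S : Finset ℕ) (t : ℕ) : ℕ := (S.filter (· < t)).card

/-- ballot condition -/
def Bal (N : ℕ) (S : Finset ℕ) : Prop := ∀ t ≤ N, t ≤ 2 * upc S t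

open Classical in
noncomputable def ballotF (N u : ℕ) : Finset (Finset ℕ) :=
  ((Finset.range N).powersetCard u).filter (Bal N)

lemma upc_succ (S : Finset ℕ) (t : ℕ) : upc S (t+1) = upc S t + if t ∈ S then 1 else 0 := by
  unfold upc
  have : S.filter (· < t+1) = S.filter (· < t) ∪ S.filter (· = t) := by
    ext x; simp only [Finset.mem_filter, Finset.mem_union]; grind
  rw [this, Finset.card_union_of_disjoint]
  · congr 1
    split_ifs with h
    · rw [Finset.card_eq_one]; exact ⟨t, by ext x; simp; grind⟩
    · rw [Finset.card_eq_zero]; ext x; simp; grind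
  · rw [Finset.disjoint_left]; intro x; simp; grind

lemma upc_full {N : ℕ} {S : Finset ℕ} (h : S ⊆ Finset.range N) : upc S N = S.card := by
  unfold upc
  rw [Finset.filter_true_of_mem]
  intro x hx; simpa using h hx

lemma upc_insert {N : ℕ} {S : Finset ℕ} {t : ℕ} (ht : t ≤ N) : upc (insert N S) t = upc S t := by
  unfold upc
  congr 1
  ext x; simp; intro h h2; omega

lemma bal_succ {N : ℕ} {S : Finset ℕ} :
    Bal (N+1) S ↔ Bal N S ∧ N + 1 ≤ 2 * upc S (N+1) := by
  unfold Bal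
  constructor
  · intro h; exact ⟨fun t ht => h t (by omega), h _ le_rfl⟩
  · rintro ⟨h1, h2⟩ t ht
    rcases Nat.lt_or_ge N t with h | h
    · have : t = N + 1 := by omega
      subst this; exact h2
    · exact h1 t h

lemma bal_insert {N : ℕ} {S : Finset ℕ} : Bal N (insert N S) ↔ Bal N S := by
  unfold Bal
  refine forall_congr' fun t => forall_congr' fun ht => ?_
  rw [upc_insert ht]

lemma ballot_zero (N : ℕ) (u : ℕ) (h : 2 * u < N) : ballotF N u = ∅ := by
  ext S
  simp only [ballotF, Finset.mem_filter, Finset.mem_powersetCard, Finset.notMem_empty, iff_false]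
  rintro ⟨⟨h1, h2⟩, h3⟩
  have := h3 N le_rfl
  rw [upc_full h1] at this; omega

open Classical in
lemma ballot_rec (N u : ℕ) (h : N + 1 ≤ 2 * (u+1)) :
    (ballotF (N+1) (u+1)).card = (ballotF N u).card + (ballotF N (u+1)).card := by
  have hset : ballotF (N+1) (u+1) = ballotF N (u+1) ∪ (ballotF N u).image (insert N) := by
    ext S
    simp only [ballotF, Finset.range_add_one, Finset.powersetCard_succ_insert Finset.notMem_range_self, Finset.mem_filter, Finset.mem_union, Finset.mem_image, Finset.mem_powersetCard]
    constructor
    · rintro ⟨h1 | ⟨T, ⟨h1, h1'⟩, rfl⟩, h2⟩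
      · exact Or.inl ⟨h1, (bal_succ.1 h2).1⟩
      · exact Or.inr ⟨T, ⟨⟨h1, h1'⟩, bal_insert.1 (bal_succ.1 h2).1⟩, rfl⟩
    · rintro (⟨⟨h1, h1'⟩, h2⟩ | ⟨T, ⟨⟨h1, h1'⟩, h2⟩, rfl⟩)
      · refine ⟨Or.inl ⟨h1, h1'⟩, bal_succ.2 ⟨h2, ?_⟩⟩
        rw [upc_full (h1.trans (by simp)), h1']; omega
      · refine ⟨Or.inr ⟨T, ⟨h1, h1'⟩, rfl⟩, bal_succ.2 ⟨bal_insert.2 h2, ?_⟩⟩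
        rw [upc_full, Finset.card_insert_of_notMem, h1']
        · omega
        · intro h; simpa using h1 h
        · rw [Finset.range_add_one]; exact Finset.insert_subset_insert _ h1
  rw [hset, Finset.card_union_of_disjoint, Finset.card_image_of_injOn, add_comm]
  · intro A hA B hB hAB
    simp only [ballotF, Finset.coe_filter, Finset.mem_powersetCard, Set.mem_ofPred_eq] at hA hB
    have ha : N ∉ A := fun h => by simpa using hA.1.1 h
    have hb : N ∉ B := fun h => by simpa using hB.1.1 h
    have := congrArg (fun X => Finset.erase X N) hAB
    simpa [Finset.erase_insert, ha, hb] using this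
  · rw [Finset.disjoint_left]
    intro A hA hB
    simp only [ballotF, Finset.mem_filter, Finset.mem_powersetCard, Finset.mem_image] at hA hB
    obtain ⟨T, _, rfl⟩ := hB
    have := hA.1.1 (Finset.mem_insert_self N T)
    simp at this

lemma ballot_card (N u : ℕ) (h : N ≤ 2 * u + 1) :
    (ballotF N u).card + N.choose (u+1) = N.choose u := by
  induction N generalizing u with
  | zero =>
    rcases u with _ | u
    · simp [ballotF, Bal, Finset.filter_singleton]
    · simp [ballotF]
  | succ N ih =>
    by_cases h2 : N + 1 = 2 * u + 1
    · rw [ballot_zero _ _ (by omega), h2]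
      have := Nat.choose_symm_half u
      simp [this]
    · rcases u with _ | u
      · omega
      rw [ballot_rec N u (by omega)]
      have h1 := ih u (by omega)
      have h3 := ih (u+1) (by omega)
      rw [Nat.choose_succ_succ' N (u+1), Nat.choose_succ_succ' N u]
      omega

open Classical in
noncomputable def ballotAll (N : ℕ) : Finset (Finset ℕ) :=
  ((Finset.range N).powerset).filter (Bal N)

lemma ballotAll_card_aux (N u k : ℕ) (h : N ≤ 2 * u + 1) (hk : N < u + k) :
    ∑ i ∈ Finset.range k, (ballotF N (u + i)).card = N.choose u := by
  have : ∀ j, ∑ i ∈ Finset.range j, (ballotF N (u + i)).card + N.choose (u+j) = N.choose u := by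
    intro j
    induction j with
    | zero => simp
    | succ j ih =>
      rw [Finset.sum_range_succ]
      have := ballot_card N (u+j) (by omega)
      rw [← ih, ← add_assoc u j 1]; omega
  have h2 := this k
  rw [Nat.choose_eq_zero_of_lt hk] at h2
  simpa using h2

open Classical in
lemma ballotAll_card (n : ℕ) : (ballotAll (2*n+1)).card = (2*n+1).choose (n+1) := by
  rw [← ballotAll_card_aux (2*n+1) (n+1) (n+1) (by omega) (by omega)]
  rw [← Finset.card_biUnion]
  · congr 1
    ext S
    simp only [ballotAll, ballotF, Finset.mem_filter, Finset.mem_powerset, Finset.mem_biUnion, Finset.mem_range, Finset.mem_powersetCard]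
    constructor
    · rintro ⟨h1, h2⟩
      have h3 := h2 _ le_rfl
      rw [upc_full h1] at h3
      have h4 := Finset.card_le_card h1
      rw [Finset.card_range] at h4
      exact ⟨S.card - (n+1), by omega, ⟨h1, by omega⟩, h2⟩
    · rintro ⟨i, _, ⟨h1, _⟩, h2⟩; exact ⟨h1, h2⟩
  · intro i _ j _ hij
    simp only [Function.onFun, Finset.disjoint_left, ballotF, Finset.mem_filter, Finset.mem_powersetCard]
    rintro A ⟨⟨_, h⟩, _⟩ ⟨⟨_, h'⟩, _⟩
    omega

/-- linear non-crossing condition -/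
def LNC (L : ℕ) (P : Setoid (ZMod L)) : Prop :=
  ∀ a b c d : ZMod L, a.val < b.val → b.val < c.val → c.val < d.val → P.r a c → P.r b d → P.r a b

lemma val_sub_cases {L : ℕ} [NeZero L] (a t : ZMod L) :
    a.val = (a - t).val + t.val ∨ a.val + L = (a - t).val + t.val := by
  have h := ZMod.val_add (a - t) t
  rw [sub_add_cancel] at h
  have h1 := ZMod.val_lt (a - t)
  have h2 := ZMod.val_lt t
  rcases Nat.lt_or_ge ((a - t).val + t.val) L with h3 | h3
  · rw [Nat.mod_eq_of_lt h3] at h; omega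
  · rw [Nat.mod_eq_sub_mod h3, Nat.mod_eq_of_lt (by omega)] at h; omega

lemma isNC_iff_LNC {L : ℕ} [NeZero L] (P : Setoid (ZMod L)) : IsNC L P ↔ LNC L P := by
  constructor
  · intro h a b c d h1 h2 h3 hac hbd
    by_contra hab
    exact h ⟨a, b, c, d, ⟨0, by simpa using ⟨h1, h2, h3⟩⟩, hac, hbd, hab⟩
  · rintro h ⟨a, b, c, d, ⟨t, h1, h2, h3⟩, hac, hbd, hab⟩
    apply hab
    have ha := val_sub_cases a t
    have hb := val_sub_cases b t
    have hc := val_sub_cases c t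
    have hd := val_sub_cases d t
    have la := ZMod.val_lt (a - t)
    have lb := ZMod.val_lt (b - t)
    have lc := ZMod.val_lt (c - t)
    have ld := ZMod.val_lt (d - t)
    have la' := ZMod.val_lt a
    have lb' := ZMod.val_lt b
    have lc' := ZMod.val_lt c
    have ld' := ZMod.val_lt d
    have hca := P.symm' hac
    have hdb := P.symm' hbd
    have key : (a.val < b.val ∧ b.val < c.val ∧ c.val < d.val) ∨
      (b.val < c.val ∧ c.val < d.val ∧ d.val < a.val) ∨
      (c.val < d.val ∧ d.val < a.val ∧ a.val < b.val) ∨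
      (d.val < a.val ∧ a.val < b.val ∧ b.val < c.val) := by omega
    rcases key with ⟨k1, k2, k3⟩ | ⟨k1, k2, k3⟩ | ⟨k1, k2, k3⟩ | ⟨k1, k2, k3⟩
    · exact h a b c d k1 k2 k3 hac hbd
    · exact P.trans' hac (P.symm' (h b c d a k1 k2 k3 hbd hca))
    · exact P.trans' hac (P.trans' (h c d a b k1 k2 k3 hca hdb) hdb)
    · exact P.trans' (P.symm' (h d a b c k1 k2 k3 hdb hac)) hdb

/-- the partition given by a height function -/
def hRel {L : ℕ} (h : ℕ → ℤ) (x y : ZMod L) : Prop :=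
  h (2 * x.val + 1) = h (2 * y.val + 1) ∧
    ∀ t, (2 * x.val + 1 ≤ t ∧ t ≤ 2 * y.val + 1 ∨ 2 * y.val + 1 ≤ t ∧ t ≤ 2 * x.val + 1) →
      h (2 * x.val + 1) ≤ h t

def hSetoid (L : ℕ) (h : ℕ → ℤ) : Setoid (ZMod L) where
  r := hRel h
  iseqv := by
    refine ⟨?_, ?_, ?_⟩
    · intro x
      refine ⟨rfl, fun t ht => ?_⟩
      have : t = 2 * x.val + 1 := by omega
      rw [this]
    · rintro x y ⟨h1, h2⟩
      exact ⟨h1.symm, fun t ht => h1 ▸ h2 t ht.symm⟩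
    · rintro x y z ⟨h1, h2⟩ ⟨h3, h4⟩
      refine ⟨h1.trans h3, fun t ht => ?_⟩
      by_cases hc : (2 * x.val + 1 ≤ t ∧ t ≤ 2 * y.val + 1 ∨ 2 * y.val + 1 ≤ t ∧ t ≤ 2 * x.val + 1)
      · exact h2 t hc
      · rw [h1]; apply h4; omega

lemma hSetoid_LNC (L : ℕ) (h : ℕ → ℤ) : LNC L (hSetoid L h) := by
  rintro a b c d hab hbc hcd ⟨h1, h2⟩ ⟨h3, h4⟩
  refine ⟨?_, fun t ht => h2 t (by omega)⟩
  have e1 := h2 (2 * b.val + 1) (by omega)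
  have e2 := h4 (2 * c.val + 1) (by omega)
  omega

structure Good (L : ℕ) (h : ℕ → ℤ) : Prop where
  zero : h 0 = 0
  nonneg : ∀ t, t ≤ 2 * L → 0 ≤ h t
  step : ∀ t, t < 2 * L → h (t+1) = h t + 1 ∨ h (t+1) = h t - 1
  sym : ∀ t, t ≤ 2 * L → h (2 * L - t) = h t

lemma Good.last {L : ℕ} {h : ℕ → ℤ} (g : Good L h) : h (2 * L) = 0 := by
  have := g.sym 0 (by omega)
  rw [g.zero] at this; simpa using this

lemma Good.parity {L : ℕ} {h : ℕ → ℤ} (g : Good L h) (t : ℕ) (ht : t ≤ 2 * L) :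
    h t % 2 = (t : ℤ) % 2 := by
  induction t with
  | zero => simp [g.zero]
  | succ t ih =>
    have := ih (by omega)
    have h2 := g.step t (by omega)
    push_cast; omega

lemma rev_val {L : ℕ} [NeZero L] (x : ZMod L) : (-x - 1).val = L - 1 - x.val := by
  have h1 := val_sub_cases (-1 : ZMod L) x
  have h2 : (-1 : ZMod L).val + 1 = L := by
    obtain ⟨k, rfl⟩ := Nat.exists_eq_succ_of_ne_zero (NeZero.ne L)
    rw [ZMod.val_neg_one]
  have h3 : -x - 1 = -1 - x := by ring
  rw [h3]
  have := ZMod.val_lt x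
  have := ZMod.val_lt (-1 - x)
  omega

def RevInv (L : ℕ) (P : Setoid (ZMod L)) : Prop :=
  ∀ x y : ZMod L, P.r x y ↔ P.r (-x - 1) (-y - 1)

lemma revInv_of_imp {L : ℕ} {P : Setoid (ZMod L)}
    (h : ∀ x y : ZMod L, P.r x y → P.r (-x - 1) (-y - 1)) : RevInv L P := by
  intro x y
  refine ⟨h x y, fun hh => ?_⟩
  simpa using h _ _ hh

lemma hSetoid_rev {L : ℕ} [NeZero L] {h : ℕ → ℤ} (g : Good L h) : RevInv L (hSetoid L h) := by
  apply revInv_of_imp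
  rintro x y ⟨h1, h2⟩
  have hx := ZMod.val_lt x
  have hy := ZMod.val_lt y
  have e1 : 2 * (-x - 1).val + 1 = 2 * L - (2 * x.val + 1) := by rw [rev_val]; omega
  have e2 : 2 * (-y - 1).val + 1 = 2 * L - (2 * y.val + 1) := by rw [rev_val]; omega
  refine ⟨?_, ?_⟩
  · rw [e1, e2, g.sym _ (by omega), g.sym _ (by omega), h1]
  · rw [e1, e2, g.sym _ (by omega)]
    intro t ht
    rw [← g.sym t (by omega)]
    apply h2
    omega

/-- down steps into a position are seen by the partition -/
lemma down_iff {L : ℕ} [NeZero L] {h : ℕ → ℤ} (g : Good L h) (x : ZMod L) :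
    h (2 * x.val + 1) = h (2 * x.val) - 1 ↔ ∃ y : ZMod L, y.val < x.val ∧ hRel h y x := by
  have hx := ZMod.val_lt x
  constructor
  · intro hd
    set v := h (2 * x.val + 1) with hv
    have hv0 : 0 ≤ v := g.nonneg _ (by omega)
    let Q : ℕ → Prop := fun t => h t ≤ v
    classical
    have hQ0 : Q 0 := by show h 0 ≤ v; rw [g.zero]; exact hv0
    let t := Nat.findGreatest Q (2 * x.val)
    have ht1 : t ≤ 2 * x.val := Nat.findGreatest_le _
    have ht2 : h t ≤ v := Nat.findGreatest_spec (P := Q) (Nat.zero_le _) hQ0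
    have ht3 : ∀ s, t < s → s ≤ 2 * x.val → v < h s := by
      intro s h1 h2
      have := Nat.findGreatest_is_greatest (P := Q) h1 h2
      simpa [Q] using this
    have ht4 : t < 2 * x.val := by
      rcases Nat.lt_or_ge t (2 * x.val) with h1 | h1
      · exact h1
      · have : t = 2 * x.val := by omega
        rw [this] at ht2; omega
    have ht5 := ht3 (t+1) (by omega) (by omega)
    have ht6 := g.step t (by omega)
    have p1 := g.parity t (by omega)
    have p2 := g.parity (2 * x.val + 1) (by omega)
    rw [← hv] at p2
    have hodd : t % 2 = 1 := by push_cast at p2; omega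
    have hval : ((t / 2 : ℕ) : ZMod L).val = t / 2 := ZMod.val_natCast_of_lt (by omega)
    have htt : 2 * ((t / 2 : ℕ) : ZMod L).val + 1 = t := by rw [hval]; omega
    refine ⟨((t / 2 : ℕ) : ZMod L), by omega, ?_⟩
    unfold hRel
    rw [htt]
    refine ⟨by omega, fun s hs => ?_⟩
    rcases Nat.lt_or_ge t s with h1 | h1
    · rcases Nat.lt_or_ge (2 * x.val) s with h2 | h2
      · have : s = 2 * x.val + 1 := by omega
        rw [this]; omega
      · have := ht3 s h1 h2; omega
    · have : s = t := by omega
      rw [this]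
  · rintro ⟨y, hy, h1, h2⟩
    have := h2 (2 * x.val) (by omega)
    have := g.step (2 * x.val) (by omega)
    omega

/-- up steps out of a position are seen by the partition -/
lemma up_iff {L : ℕ} [NeZero L] {h : ℕ → ℤ} (g : Good L h) (x : ZMod L) :
    h (2 * x.val + 1 + 1) = h (2 * x.val + 1) + 1 ↔ ∃ y : ZMod L, x.val < y.val ∧ hRel h x y := by
  have hx := ZMod.val_lt x
  constructor
  · intro hd
    set v := h (2 * x.val + 1) with hv
    have hv0 : 0 ≤ v := g.nonneg _ (by omega)
    classical
    have hex : ∃ t, 2 * x.val + 2 ≤ t ∧ t ≤ 2 * L ∧ h t ≤ v :=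
      ⟨2 * L, by omega, le_rfl, by rw [g.last]; exact hv0⟩
    obtain ⟨ht1, ht2, ht3⟩ := Nat.find_spec hex
    have ht4 : ∀ s, s < Nat.find hex → 2 * x.val + 2 ≤ s → v < h s := by
      intro s h1 h2
      have := Nat.find_min hex h1
      by_contra h3
      exact this ⟨h2, by omega, by omega⟩
    set t := Nat.find hex
    have ht5 : t ≠ 2 * x.val + 2 := by
      intro h1
      have hd' : h (2 * x.val + 2) = v + 1 := hd
      rw [h1] at ht3; omega
    obtain ⟨u, hu⟩ : ∃ u, t = u + 1 := ⟨t - 1, by omega⟩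
    have ht6 := g.step u (by omega)
    have ht7 := ht4 u (by omega) (by omega)
    rw [← hu] at ht6
    have p1 := g.parity t (by omega)
    have p2 := g.parity (2 * x.val + 1) (by omega)
    rw [← hv] at p2
    have hodd : t % 2 = 1 := by push_cast at p2; omega
    have hval : ((t / 2 : ℕ) : ZMod L).val = t / 2 := ZMod.val_natCast_of_lt (by omega)
    have htt : 2 * ((t / 2 : ℕ) : ZMod L).val + 1 = t := by rw [hval]; omega
    refine ⟨((t / 2 : ℕ) : ZMod L), by omega, ?_⟩
    unfold hRel
    rw [htt, ← hv]
    refine ⟨by omega, fun s hs => ?_⟩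
    rcases Nat.lt_or_ge s t with h1 | h1
    · rcases Nat.lt_or_ge s (2 * x.val + 2) with h2 | h2
      · have : s = 2 * x.val + 1 := by omega
        rw [this]
      · have := ht4 s h1 h2; omega
    · have : s = t := by omega
      rw [this]; omega
  · rintro ⟨y, hy, h1, h2⟩
    have := h2 (2 * x.val + 1 + 1) (by omega)
    have := g.step (2 * x.val + 1) (by omega)
    omega

/-- height function of an up-step set -/
def hS (L : ℕ) (S : Finset ℕ) (t : ℕ) : ℤ :=
  if t ≤ L then 2 * (upc S t : ℤ) - t else 2 * (upc S (2 * L - t) : ℤ) - (2 * L - t : ℕ)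

lemma hS_good {L : ℕ} {S : Finset ℕ} (hb : Bal L S) : Good L (hS L S) where
  zero := by simp [hS, upc]
  nonneg := by
    intro t ht
    unfold hS
    split_ifs with h
    · have := hb t h; omega
    · have := hb (2 * L - t) (by omega); omega
  step := by
    intro t ht
    unfold hS
    rcases Nat.lt_or_ge t L with h | h
    · rw [if_pos (by omega), if_pos (by omega), upc_succ]
      split_ifs <;> push_cast <;> omega
    · rw [if_neg (by omega)]
      have e : 2 * L - t = (2 * L - (t+1)) + 1 := by omega
      have h3 := upc_succ S (2 * L - (t+1))
      rw [← e] at h3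
      split_ifs at h3 ⊢ with h1 h2
      all_goals first | (have : t = L := by omega) | skip
      all_goals first | (subst this; rw [show 2 * t - t = t by omega] at h3) | skip
      all_goals omega
  sym := by
    intro t ht
    unfold hS
    rcases Nat.lt_trichotomy t L with h | h | h
    · rw [if_neg (by omega), if_pos (by omega), show 2 * L - (2 * L - t) = t by omega]
    · subst h; simp [show 2 * t - t = t by omega]
    · rw [if_pos (by omega), if_neg (by omega)]

lemma hS_mem {L : ℕ} {S : Finset ℕ} {t : ℕ} (ht : t < L) :
    t ∈ S ↔ hS L S (t+1) = hS L S t + 1 := by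
  unfold hS
  rw [if_pos (by omega), if_pos (by omega), upc_succ]
  split_ifs with h
  · simp [h]; ring
  · simp [h]; omega

lemma hS_inj {L : ℕ} [NeZero L] {S T : Finset ℕ} (hS1 : S ⊆ Finset.range L)
    (hT1 : T ⊆ Finset.range L) (hbS : Bal L S) (hbT : Bal L T)
    (heq : hSetoid L (hS L S) = hSetoid L (hS L T)) : S = T := by
  have hr : ∀ x y : ZMod L, hRel (hS L S) x y ↔ hRel (hS L T) x y := by
    intro x y
    have := congrArg (fun P : Setoid (ZMod L) => P.r x y) heq
    exact iff_of_eq this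
  have gS := hS_good hbS
  have gT := hS_good hbT
  have main : ∀ t, t < L → (t ∈ S ↔ t ∈ T) := by
    intro t ht
    rw [hS_mem ht, hS_mem ht]
    have hval : ((t / 2 : ℕ) : ZMod L).val = t / 2 := ZMod.val_natCast_of_lt (by omega)
    rcases Nat.even_or_odd' t with ⟨k, hk | hk⟩
    · have h1 := down_iff gS ((t / 2 : ℕ) : ZMod L)
      have h2 := down_iff gT ((t / 2 : ℕ) : ZMod L)
      simp only [hr] at h1
      rw [← h2, hval, show 2 * (t / 2) = t by omega] at h1
      have s1 := gS.step t (by omega)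
      have s2 := gT.step t (by omega)
      constructor
      · intro h
        by_contra h'
        have := h1.2 (by omega)
        omega
      · intro h
        by_contra h'
        have := h1.1 (by omega)
        omega
    · have h1 := up_iff gS ((t / 2 : ℕ) : ZMod L)
      have h2 := up_iff gT ((t / 2 : ℕ) : ZMod L)
      simp only [hr] at h1
      rw [← h2, hval, show 2 * (t / 2) + 1 = t by omega] at h1
      exact h1
  ext t
  constructor
  · intro h
    exact (main t (by simpa using hS1 h)).1 h
  · intro h
    exact (main t (by simpa using hT1 h)).2 h

open Classical in
/-- blocks strictly straddling the time `t` -/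
noncomputable def strad {L : ℕ} [NeZero L] (P : Setoid (ZMod L)) (t : ℕ) : Finset (Quotient P) :=
  Finset.univ.filter fun B => ∃ a b : ZMod L, Quotient.mk P a = B ∧ Quotient.mk P b = B ∧
    2 * a.val + 1 < t ∧ t < 2 * b.val + 1 ∧ ∀ c, Quotient.mk P c = B → 2 * c.val + 1 ≠ t

lemma mem_strad {L : ℕ} [NeZero L] (P : Setoid (ZMod L)) (t : ℕ) (x : ZMod L) :
    Quotient.mk P x ∈ strad P t ↔ ∃ a b : ZMod L, P.r x a ∧ P.r x b ∧
      2 * a.val + 1 < t ∧ t < 2 * b.val + 1 ∧ ∀ c, P.r x c → 2 * c.val + 1 ≠ t := by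
  have e : ∀ a : ZMod L, Quotient.mk P a = Quotient.mk P x ↔ P.r x a := by
    intro a
    rw [Quotient.eq]
    exact ⟨fun h => P.symm' h, fun h => P.symm' h⟩
  simp only [strad, Finset.mem_filter, Finset.mem_univ, true_and, e]

noncomputable def hP {L : ℕ} [NeZero L] (P : Setoid (ZMod L)) (t : ℕ) : ℤ :=
  2 * ((strad P t).card : ℤ) + (t % 2 : ℕ)

lemma strad_sub {L : ℕ} [NeZero L] {P : Setoid (ZMod L)} {s t : ℕ}
    (h : ∀ x, Quotient.mk P x ∈ strad P s → Quotient.mk P x ∈ strad P t) :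
    (strad P s).card ≤ (strad P t).card := by
  apply Finset.card_le_card
  intro B
  induction B using Quotient.ind with
  | _ x => exact h x

open Classical in
lemma strad_sub_insert {L : ℕ} [NeZero L] {P : Setoid (ZMod L)} {s t : ℕ} (y : ZMod L)
    (h : ∀ x, Quotient.mk P x ∈ strad P s → P.r y x ∨ Quotient.mk P x ∈ strad P t) :
    (strad P s).card ≤ (strad P t).card + 1 := by
  refine le_trans (Finset.card_le_card (t := insert (Quotient.mk P y) (strad P t)) ?_)
    (Finset.card_insert_le _ _)
  intro B
  induction B using Quotient.ind with
  | _ x =>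
    intro hx
    rcases h x hx with h | h
    · apply Finset.mem_insert.2; left
      exact Quotient.sound (P.symm' h)
    · exact Finset.mem_insert_of_mem h

open Classical in
lemma strad_insert_sub {L : ℕ} [NeZero L] {P : Setoid (ZMod L)} {s t : ℕ} (y : ZMod L)
    (hy : Quotient.mk P y ∉ strad P s) (hy2 : Quotient.mk P y ∈ strad P t)
    (h : ∀ x, Quotient.mk P x ∈ strad P s → Quotient.mk P x ∈ strad P t) :
    (strad P s).card + 1 ≤ (strad P t).card := by
  rw [← Finset.card_insert_of_notMem hy]
  apply Finset.card_le_card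
  intro B hB
  rcases Finset.mem_insert.1 hB with rfl | hB
  · exact hy2
  · revert hB
    induction B using Quotient.ind with
    | _ x => exact h x

lemma strad_rev {L : ℕ} [NeZero L] {P : Setoid (ZMod L)} (hr : RevInv L P) {t : ℕ}
    (ht : t ≤ 2 * L) : (strad P t).card ≤ (strad P (2 * L - t)).card := by
  let f : Quotient P → Quotient P := Quotient.map (fun x => -x - 1) (fun x y h => (hr x y).1 h)
  apply Finset.card_le_card_of_injOn f
  · intro B
    induction B using Quotient.ind with
    | _ x =>
      intro hx
      have hx := (mem_strad P t x).1 hx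
      obtain ⟨a, b, ha, hb, h1, h2, h3⟩ := hx
      show Quotient.mk P (-x - 1) ∈ _
      rw [Finset.mem_coe, mem_strad]
      have := ZMod.val_lt a
      have := ZMod.val_lt b
      refine ⟨-b - 1, -a - 1, (hr _ _).1 hb, (hr _ _).1 ha, ?_, ?_, ?_⟩
      · rw [rev_val]; omega
      · rw [rev_val]; omega
      · intro c hc
        have h4 := (hr _ _).1 hc
        rw [show -(-x - 1) - 1 = x by ring] at h4
        have h5 := h3 _ h4
        rw [rev_val] at h5
        have := ZMod.val_lt c
        omega
  · intro A _ B _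
    induction A using Quotient.ind with
    | _ x =>
    induction B using Quotient.ind with
    | _ y =>
      intro h
      have h' : Quotient.mk P (-x - 1) = Quotient.mk P (-y - 1) := h
      rw [Quotient.eq] at h'
      exact Quotient.sound ((hr x y).2 h')

lemma hP_good {L : ℕ} [NeZero L] {P : Setoid (ZMod L)} (hr : RevInv L P) : Good L (hP P) where
  zero := by
    have : strad P 0 = ∅ := by
      ext B
      induction B using Quotient.ind with
      | _ x => rw [mem_strad]; simp
    simp [hP, this]
  nonneg := by intro t _; unfold hP; positivity
  sym := by
    intro t ht
    have h1 := strad_rev hr ht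
    have h2 := strad_rev hr (t := 2 * L - t) (by omega)
    rw [show 2 * L - (2 * L - t) = t by omega] at h2
    unfold hP
    omega
  step := by
    intro t ht
    have hval : ((t / 2 : ℕ) : ZMod L).val = t / 2 := ZMod.val_natCast_of_lt (by omega)
    set p := ((t / 2 : ℕ) : ZMod L) with hp
    have huniq : ∀ c : ZMod L, c.val = t / 2 → c = p := by
      intro c hc
      apply ZMod.val_injective
      omega
    rcases Nat.even_or_odd' t with ⟨k, hk | hk⟩
    · have h1 : (strad P (t+1)).card ≤ (strad P t).card := by
        apply strad_sub
        intro x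
        rw [mem_strad, mem_strad]
        rintro ⟨a, b, ha, hb, h1, h2, h3⟩
        have := h3 a ha
        exact ⟨a, b, ha, hb, by omega, by omega, fun c _ => by omega⟩
      have h2 : (strad P t).card ≤ (strad P (t+1)).card + 1 := by
        apply strad_sub_insert p
        intro x
        rw [mem_strad, mem_strad]
        rintro ⟨a, b, ha, hb, h1, h2, h3⟩
        by_cases hpx : P.r p x
        · exact Or.inl hpx
        have hne : ∀ c, P.r x c → 2 * c.val + 1 ≠ t + 1 := by
          intro c hc hc2
          have := huniq c (by omega)
          subst this
          exact hpx (P.symm' hc)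
        have := hne b hb
        exact Or.inr ⟨a, b, ha, hb, by omega, by omega, hne⟩
      unfold hP
      omega
    · have h1 : (strad P t).card ≤ (strad P (t+1)).card := by
        apply strad_sub
        intro x
        rw [mem_strad, mem_strad]
        rintro ⟨a, b, ha, hb, h1, h2, h3⟩
        exact ⟨a, b, ha, hb, by omega, by omega, fun c _ => by omega⟩
      have h2 : (strad P (t+1)).card ≤ (strad P t).card + 1 := by
        apply strad_sub_insert p
        intro x
        rw [mem_strad, mem_strad]
        rintro ⟨a, b, ha, hb, h1, h2, h3⟩
        by_cases hpx : P.r p x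
        · exact Or.inl hpx
        have hne : ∀ c, P.r x c → 2 * c.val + 1 ≠ t := by
          intro c hc hc2
          have := huniq c (by omega)
          subst this
          exact hpx (P.symm' hc)
        have := hne a ha
        exact Or.inr ⟨a, b, ha, hb, by omega, by omega, hne⟩
      unfold hP
      omega

lemma not_strad_self {L : ℕ} [NeZero L] (P : Setoid (ZMod L)) (x y : ZMod L) (h : P.r y x) :
    Quotient.mk P y ∉ strad P (2 * x.val + 1) := by
  rw [mem_strad]
  rintro ⟨a, b, ha, hb, h1, h2, h3⟩
  exact h3 x h rfl

/-- blocks over `x` cover everything up to a later related `y` -/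
lemma strad_right {L : ℕ} [NeZero L] {P : Setoid (ZMod L)} (hn : LNC L P) {x y : ZMod L}
    (hxy : P.r x y) {t : ℕ} (h1 : 2 * x.val + 1 ≤ t) (h2 : t ≤ 2 * y.val + 1) (z : ZMod L)
    (hz : Quotient.mk P z ∈ strad P (2 * x.val + 1)) : Quotient.mk P z ∈ strad P t := by
  rw [mem_strad] at hz ⊢
  obtain ⟨a, b, ha, hb, h3, h4, h5⟩ := hz
  have hzx : ¬ P.r z x := fun h => h5 x h rfl
  have key : ∀ c, P.r z c → x.val < c.val → y.val < c.val := by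
    intro c hc hxc
    by_contra hcy
    rcases Nat.lt_or_ge c.val y.val with h | h
    · apply hzx
      exact P.trans' ha (hn a x c y (by omega) hxc h (P.trans' (P.symm' ha) hc) hxy)
    · have : c = y := ZMod.val_injective _ (by omega)
      subst this
      exact hzx (P.trans' hc (P.symm' hxy))
  have hb2 := key b hb (by omega)
  refine ⟨a, b, ha, hb, by omega, by omega, fun c hc hct => ?_⟩
  have hcx := h5 c hc
  have := key c hc (by omega)
  omega

lemma strad_left {L : ℕ} [NeZero L] {P : Setoid (ZMod L)} (hn : LNC L P) {x y : ZMod L}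
    (hxy : P.r x y) {t : ℕ} (h1 : 2 * x.val + 1 ≤ t) (h2 : t ≤ 2 * y.val + 1) (z : ZMod L)
    (hz : Quotient.mk P z ∈ strad P (2 * y.val + 1)) : Quotient.mk P z ∈ strad P t := by
  rw [mem_strad] at hz ⊢
  obtain ⟨a, b, ha, hb, h3, h4, h5⟩ := hz
  have hzx : ¬ P.r z y := fun h => h5 y h rfl
  have key : ∀ c, P.r z c → c.val < y.val → c.val < x.val := by
    intro c hc hxc
    by_contra hcy
    rcases Nat.lt_or_ge x.val c.val with h | h
    · apply hzx
      have := hn x c y b h hxc (by omega) hxy (P.trans' (P.symm' hc) hb)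
      exact P.trans' hc (P.trans' (P.symm' this) hxy)
    · have : c = x := ZMod.val_injective _ (by omega)
      subst this
      exact hzx (P.trans' hc hxy)
  have hb2 := key a ha (by omega)
  refine ⟨a, b, ha, hb, by omega, by omega, fun c hc hct => ?_⟩
  have hcx := h5 c hc
  have := key c hc (by omega)
  omega

lemma hRel_of_rel {L : ℕ} [NeZero L] {P : Setoid (ZMod L)} (hn : LNC L P) {x y : ZMod L}
    (hxy : P.r x y) (hlt : x.val ≤ y.val) : hRel (hP P) x y := by
  have a1 := strad_sub (strad_right hn hxy (t := 2 * y.val + 1) (by omega) le_rfl)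
  have a2 := strad_sub (strad_left hn hxy (t := 2 * x.val + 1) le_rfl (by omega))
  refine ⟨?_, fun t ht => ?_⟩
  · unfold hP; omega
  · have ht1 : 2 * x.val + 1 ≤ t := by omega
    have ht2 : t ≤ 2 * y.val + 1 := by omega
    have a3 := strad_right hn hxy ht1 ht2
    rcases Nat.even_or_odd' t with ⟨k, hk | hk⟩
    · have := strad_insert_sub x (not_strad_self P x x (P.refl' x)) (t := t)
        ((mem_strad P t x).2 ⟨x, y, P.refl' x, hxy, by omega, by omega, fun c _ => by omega⟩) a3
      unfold hP; omega
    · have := strad_sub a3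
      unfold hP; omega

lemma rel_of_hRel {L : ℕ} [NeZero L] {P : Setoid (ZMod L)} (hn : LNC L P) {x y : ZMod L}
    (hlt : x.val < y.val) (hR : hRel (hP P) x y) : P.r x y := by
  classical
  by_contra hxy
  obtain ⟨h1, h2⟩ := hR
  let T : Finset (ZMod L) := Finset.univ.filter fun z => P.r x z ∧ z.val < y.val
  obtain ⟨j, hj, hjm⟩ := T.exists_max_image (fun z => z.val) ⟨x, by simp [T, hlt]⟩
  simp only [T, Finset.mem_filter, Finset.mem_univ, true_and] at hj hjm
  obtain ⟨hxj, hjy⟩ := hj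
  have hxj' : x.val ≤ j.val := hjm x ⟨P.refl' x, hlt⟩
  have hRj := (hRel_of_rel hn hxj hxj').1
  by_cases hex : ∃ b, P.r x b ∧ j.val < b.val
  · obtain ⟨b, hxb, hjb⟩ := hex
    have hyb : y.val < b.val := by
      by_contra hc
      rcases Nat.lt_or_ge b.val y.val with h | h
      · have := hjm b ⟨hxb, h⟩; omega
      · have : b = y := ZMod.val_injective _ (by omega)
        subst this; exact hxy hxb
    have hjb' : P.r j b := P.trans' (P.symm' hxj) hxb
    have a3 := strad_right hn hjb' (t := 2 * y.val + 1) (by omega) (by omega)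
    have := strad_insert_sub x (not_strad_self P j x hxj) (t := 2 * y.val + 1)
      ((mem_strad P _ x).2 ⟨j, b, hxj, hxb, by omega, by omega, fun c hc hc2 => by
        have : c = y := ZMod.val_injective _ (by omega)
        subst this; exact hxy hc⟩) a3
    unfold hP at hRj h1
    omega
  · have h3 := h2 (2 * j.val + 2) (by omega)
    have : (strad P (2 * j.val + 2)).card ≤ (strad P (2 * j.val + 1)).card := by
      apply strad_sub
      intro z
      rw [mem_strad, mem_strad]
      rintro ⟨a, b, ha, hb, h4, h5, h6⟩
      have hzj : ¬ P.r z j := by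
        intro h
        exact hex ⟨b, P.trans' hxj (P.trans' (P.symm' h) hb), by omega⟩
      have hne : ∀ c, P.r z c → 2 * c.val + 1 ≠ 2 * j.val + 1 := by
        intro c hc hc2
        have : c = j := ZMod.val_injective _ (by omega)
        subst this; exact hzj hc
      have := hne a ha
      exact ⟨a, b, ha, hb, by omega, by omega, hne⟩
    unfold hP at hRj h3
    omega

lemma hSetoid_hP {L : ℕ} [NeZero L] {P : Setoid (ZMod L)} (hn : LNC L P) :
    hSetoid L (hP P) = P := by
  ext x y
  show hRel (hP P) x y ↔ P.r x y
  have symm : ∀ {x y : ZMod L}, hRel (hP P) x y → hRel (hP P) y x :=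
    fun h => (hSetoid L (hP P)).symm' h
  constructor
  · intro h
    rcases Nat.lt_trichotomy x.val y.val with hl | hl | hl
    · exact rel_of_hRel hn hl h
    · have : x = y := ZMod.val_injective _ hl
      subst this; exact P.refl' x
    · exact P.symm' (rel_of_hRel hn hl (symm h))
  · intro h
    rcases Nat.le_total x.val y.val with hl | hl
    · exact hRel_of_rel hn h hl
    · exact symm (hRel_of_rel hn (P.symm' h) hl)

/-- every good height function is an `hS` on the relevant range -/
lemma good_eq_hS {L : ℕ} {h : ℕ → ℤ} (g : Good L h) :
    ∃ S, S ⊆ Finset.range L ∧ Bal L S ∧ ∀ t ≤ 2 * L, hS L S t = h t := by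
  classical
  let S := (Finset.range L).filter fun t => h (t+1) = h t + 1
  have key : ∀ t ≤ L, h t = 2 * (upc S t : ℤ) - t := by
    intro t ht
    induction t with
    | zero => simp [g.zero, upc]
    | succ t ih =>
      have h1 := ih (by omega)
      have h2 := g.step t (by omega)
      have h3 : t ∈ S ↔ h (t+1) = h t + 1 := by simp [S]; omega
      rw [upc_succ]
      split_ifs with h4
      · have := h3.1 h4; push_cast; omega
      · have : h (t+1) ≠ h t + 1 := fun h => h4 (h3.2 h)
        push_cast; omega
  refine ⟨S, Finset.filter_subset _ _, fun t ht => ?_, fun t ht => ?_⟩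
  · have := key t ht
    have := g.nonneg t (by omega)
    omega
  · unfold hS
    split_ifs with h1
    · exact (key t h1).symm
    · rw [← g.sym t ht]
      exact (key _ (by omega)).symm

lemma hSetoid_congr {L : ℕ} [NeZero L] {h k : ℕ → ℤ} (hk : ∀ t ≤ 2 * L, h t = k t) :
    hSetoid L h = hSetoid L k := by
  have : ∀ {h k : ℕ → ℤ}, (∀ t ≤ 2 * L, h t = k t) → ∀ x y : ZMod L, hRel h x y → hRel k x y := by
    rintro h k hk x y ⟨h1, h2⟩
    have hx := ZMod.val_lt x
    have hy := ZMod.val_lt y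
    refine ⟨?_, fun t ht => ?_⟩
    · rw [← hk _ (by omega), ← hk _ (by omega), h1]
    · rw [← hk _ (by omega), ← hk _ (by omega)]; exact h2 t ht
  ext x y
  exact ⟨this hk x y, this (fun t ht => (hk t ht).symm) x y⟩

lemma card_sym (n : ℕ) : Nat.card {P : NCPart (2 * n + 1) // RevInv (2 * n + 1) P.1} =
    (2 * n + 1).choose (n + 1) := by
  rw [← ballotAll_card]
  have hm : ∀ S, S ∈ ballotAll (2 * n + 1) ↔
      S ⊆ Finset.range (2 * n + 1) ∧ Bal (2 * n + 1) S := by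
    intro S; simp [ballotAll]
  let f : ballotAll (2 * n + 1) → {P : NCPart (2 * n + 1) // RevInv (2 * n + 1) P.1} :=
    fun S => ⟨⟨hSetoid (2 * n + 1) (hS (2 * n + 1) S.1),
      (isNC_iff_LNC _).2 (hSetoid_LNC _ _)⟩, hSetoid_rev (hS_good ((hm _).1 S.2).2)⟩
  have hf : Function.Bijective f := by
    constructor
    · intro S T h
      have h1 := congrArg (fun Q => Q.1.1) h
      exact Subtype.ext (hS_inj ((hm _).1 S.2).1 ((hm _).1 T.2).1 ((hm _).1 S.2).2
        ((hm _).1 T.2).2 h1)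
    · rintro ⟨⟨P, hP1⟩, hP2⟩
      have hn := (isNC_iff_LNC P).1 hP1
      obtain ⟨S, h1, h2, h3⟩ := good_eq_hS (hP_good hP2)
      refine ⟨⟨S, (hm S).2 ⟨h1, h2⟩⟩, ?_⟩
      apply Subtype.ext
      apply Subtype.ext
      show hSetoid _ _ = P
      rw [hSetoid_congr h3, hSetoid_hP hn]
  rw [← Nat.card_congr (Equiv.ofBijective f hf)]
  simp

/-- the dihedral group acting on points -/
def dihMap {L : ℕ} : DihedralGroup L → ZMod L → ZMod L
  | .r i, x => x + i
  | .sr i, x => -x - i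

lemma dihMap_mul {L : ℕ} (g h : DihedralGroup L) (x : ZMod L) :
    dihMap (g * h) x = dihMap g (dihMap h x) := by
  rcases g with i | i <;> rcases h with j | j <;> simp [dihMap] <;> ring

lemma dihMap_one {L : ℕ} (x : ZMod L) : dihMap 1 x = x := by
  rw [DihedralGroup.one_def]; simp [dihMap]

lemma isNC_comap {L : ℕ} [NeZero L] (g : DihedralGroup L) {P : Setoid (ZMod L)} (h : IsNC L P) :
    IsNC L (P.comap (dihMap g)) := by
  rintro ⟨a, b, c, d, ⟨t, h1, h2, h3⟩, hac, hbd, hab⟩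
  rcases g with i | i
  · refine h ⟨a + i, b + i, c + i, d + i, ⟨t + i, ?_⟩, hac, hbd, hab⟩
    simpa using ⟨h1, h2, h3⟩
  · have key : ∀ x : ZMod L, (-x - i - (1 - t - i)).val = L - 1 - (x - t).val := by
      intro x
      rw [← rev_val]; congr 1; ring
    refine h ⟨-d - i, -c - i, -b - i, -a - i, ⟨1 - t - i, ?_⟩, P.symm' hbd, P.symm' hac, ?_⟩
    · simp only [key]
      have := ZMod.val_lt (a - t)
      have := ZMod.val_lt (b - t)
      have := ZMod.val_lt (c - t)
      have := ZMod.val_lt (d - t)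
      omega
    · intro h4
      exact hab (P.trans' hac (P.trans' (P.symm' h4) (P.symm' hbd)))

instance dihAction (L : ℕ) [NeZero L] : MulAction (DihedralGroup L) (NCPart L) where
  smul g P := ⟨P.1.comap (dihMap g⁻¹), isNC_comap _ P.2⟩
  one_smul P := by
    apply Subtype.ext
    ext x y
    show P.1.r (dihMap 1⁻¹ x) (dihMap 1⁻¹ y) ↔ P.1.r x y
    rw [inv_one, dihMap_one, dihMap_one]
  mul_smul g h P := by
    apply Subtype.ext
    ext x y
    show P.1.r (dihMap (g * h)⁻¹ x) (dihMap (g * h)⁻¹ y) ↔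
      P.1.r (dihMap h⁻¹ (dihMap g⁻¹ x)) (dihMap h⁻¹ (dihMap g⁻¹ y))
    rw [mul_inv_rev, dihMap_mul, dihMap_mul]

lemma smul_eq_iff {L : ℕ} [NeZero L] (g : DihedralGroup L) (P Q : NCPart L) :
    g • P = Q ↔ ∀ x y, P.1.r x y ↔ Q.1.r (dihMap g x) (dihMap g y) := by
  have e : ∀ x, dihMap g⁻¹ (dihMap g x) = x := by
    intro x; rw [← dihMap_mul, inv_mul_cancel, dihMap_one]
  have e' : ∀ x, dihMap g (dihMap g⁻¹ x) = x := by
    intro x; rw [← dihMap_mul, mul_inv_cancel, dihMap_one]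
  constructor
  · rintro rfl x y
    show _ ↔ P.1.r (dihMap g⁻¹ (dihMap g x)) (dihMap g⁻¹ (dihMap g y))
    rw [e, e]
  · intro h
    apply Subtype.ext
    ext x y
    show P.1.r (dihMap g⁻¹ x) (dihMap g⁻¹ y) ↔ Q.1.r x y
    rw [h, e', e']

def rotHom (L : ℕ) : Multiplicative (ZMod L) →* DihedralGroup L where
  toFun i := .r i.toAdd
  map_one' := rfl
  map_mul' i j := by simp

instance rotAction (L : ℕ) [NeZero L] : MulAction (Multiplicative (ZMod L)) (NCPart L) :=
  MulAction.compHom _ (rotHom L)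

lemma rot_smul {L : ℕ} [NeZero L] (i : Multiplicative (ZMod L)) (P : NCPart L) :
    i • P = (DihedralGroup.r i.toAdd) • P := rfl

instance finNC (L : ℕ) [NeZero L] : Finite (NCPart L) := by
  have : Function.Injective (fun (P : NCPart L) => (P.1.r : ZMod L → ZMod L → Prop)) := by
    intro P Q h
    apply Subtype.ext
    ext x y
    exact iff_of_eq (congrFun (congrFun h x) y)
  exact Finite.of_injective _ this

lemma quot_card_congr {α : Type*} {r s : α → α → Prop} (h : ∀ a b, r a b ↔ s a b) :
    Nat.card (Quot r) = Nat.card (Quot s) :=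
  Nat.card_congr (Quot.congrRight h)

lemma N_C_eq (L : ℕ) [NeZero L] :
    N_C L = Nat.card (MulAction.orbitRel.Quotient (Multiplicative (ZMod L)) (NCPart L)) := by
  unfold N_C MulAction.orbitRel.Quotient
  apply quot_card_congr
  intro P Q
  show _ ↔ P ∈ MulAction.orbit _ Q
  rw [MulAction.mem_orbit_symm]
  constructor
  · rintro ⟨t, ht⟩
    exact ⟨Multiplicative.ofAdd t, (smul_eq_iff (.r t) P Q).2 ht⟩
  · rintro ⟨t, ht⟩
    exact ⟨t.toAdd, (smul_eq_iff (.r t.toAdd) P Q).1 ht⟩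

lemma N_D_eq (L : ℕ) [NeZero L] :
    N_D L = Nat.card (MulAction.orbitRel.Quotient (DihedralGroup L) (NCPart L)) := by
  unfold N_D MulAction.orbitRel.Quotient
  apply quot_card_congr
  intro P Q
  show _ ↔ P ∈ MulAction.orbit _ Q
  rw [MulAction.mem_orbit_symm]
  constructor
  · rintro ⟨t, ht | ht⟩
    · exact ⟨.r t, (smul_eq_iff (.r t) P Q).2 ht⟩
    · refine ⟨.sr (-t), (smul_eq_iff (.sr (-t)) P Q).2 ?_⟩
      simpa [dihMap] using ht
  · rintro ⟨t | t, ht⟩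
    · exact ⟨t, Or.inl ((smul_eq_iff (.r t) P Q).1 ht)⟩
    · refine ⟨-t, Or.inr ?_⟩
      have := (smul_eq_iff (.sr t) P Q).1 ht
      simpa [dihMap, sub_eq_add_neg] using this

lemma fix_sr (n : ℕ) (i : ZMod (2 * n + 1)) :
    Nat.card (MulAction.fixedBy (NCPart (2 * n + 1)) (DihedralGroup.sr i)) =
      (2 * n + 1).choose (n + 1) := by
  rw [← card_sym]
  have h0 : Nat.card (MulAction.fixedBy (NCPart (2 * n + 1)) (DihedralGroup.sr i)) =
      Nat.card (MulAction.fixedBy (NCPart (2 * n + 1))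
        (DihedralGroup.sr (1 : ZMod (2 * n + 1)))) := by
    let k : ZMod (2 * n + 1) := (n + 1) * (i - 1)
    have hk : k + k = i - 1 := by
      have : ((2 * n + 1 : ℕ) : ZMod (2 * n + 1)) = 0 := ZMod.natCast_self _
      push_cast at this
      have h2 : k + k = (2 * n + 1) * (i - 1) + (i - 1) := by simp only [k]; ring
      rw [h2, this]; ring
    have hc : DihedralGroup.r k * DihedralGroup.sr i * (DihedralGroup.r k)⁻¹ =
        DihedralGroup.sr (1 : ZMod (2 * n + 1)) := by
      simp only [DihedralGroup.r_mul_sr, DihedralGroup.inv_r, DihedralGroup.sr_mul_r]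
      congr 1
      have : i - k + -k = i - (k + k) := by ring
      rw [this, hk]; ring
    rw [← hc, ← MulAction.smul_fixedBy]
    exact (Nat.card_congr (MulAction.toPerm (DihedralGroup.r k) |>.image _)).trans rfl
  rw [h0]
  apply Nat.card_congr
  apply Equiv.subtypeEquivRight
  intro P
  rw [MulAction.mem_fixedBy, smul_eq_iff]
  rfl

lemma burnside_diff (n : ℕ) :
    2 * N_D (2 * n + 1) = N_C (2 * n + 1) + (2 * n + 1).choose (n + 1) := by
  classical
  set L := 2 * n + 1 with hL
  have : Fintype (NCPart L) := Fintype.ofFinite _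
  have hD := MulAction.sum_card_fixedBy_eq_card_orbits_mul_card_group (DihedralGroup L) (NCPart L)
  have hC := MulAction.sum_card_fixedBy_eq_card_orbits_mul_card_group
    (Multiplicative (ZMod L)) (NCPart L)
  simp only [← Nat.card_eq_fintype_card] at hD hC
  have eD := N_D_eq L
  have eC := N_C_eq L
  unfold MulAction.orbitRel.Quotient at eD eC
  rw [← eD, DihedralGroup.nat_card] at hD
  rw [← eC] at hC
  have hcm : Nat.card (Multiplicative (ZMod L)) = L := Nat.card_zmod L
  rw [hcm] at hC
  let e : ZMod L ⊕ ZMod L ≃ DihedralGroup L :=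
    { toFun := fun s => match s with
        | .inl i => .r i
        | .inr i => .sr i
      invFun := fun g => match g with
        | .r i => .inl i
        | .sr i => .inr i
      left_inv := by rintro (i | i) <;> rfl
      right_inv := by rintro (i | i) <;> rfl }
  rw [← e.sum_comp, Fintype.sum_sum_type] at hD
  have h1 : ∑ i : ZMod L, Nat.card (MulAction.fixedBy (NCPart L) (e (.inl i))) = N_C L * L := by
    rw [← hC]
    exact (Multiplicative.ofAdd.sum_comp fun i : Multiplicative (ZMod L) =>
      Nat.card (MulAction.fixedBy (NCPart L) i))
  have h2 : ∑ i : ZMod L, Nat.card (MulAction.fixedBy (NCPart L) (e (.inr i))) =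
      L * L.choose (n + 1) := by
    have h3 : ∀ i : ZMod L, Nat.card (MulAction.fixedBy (NCPart L) (e (.inr i))) =
        L.choose (n + 1) := fun i => fix_sr n i
    simp only [h3, Finset.sum_const, Finset.card_univ, ZMod.card, smul_eq_mul]
  rw [h1, h2] at hD
  have hpos : 0 < L := by omega
  apply Nat.eq_of_mul_eq_mul_right hpos
  linarith

/-- Odd-width case of Theorem 1:
`2·N_D(L) − N_C(L) = (1/2)·binom(L+1, (L+1)/2)` for odd `L ≥ 1`. -/
theorem two_ND_sub_NC_of_odd (L : ℕ) (hL : 1 ≤ L) (hLodd : Odd L) :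
    (2 * N_D L : ℚ) - (N_C L : ℚ) = (Nat.choose (L + 1) ((L + 1) / 2) : ℚ) / 2 := by
  obtain ⟨n, rfl⟩ := hLodd
  have h := burnside_diff n
  have h1 : (2 * n + 1 + 1) / 2 = n + 1 := by omega
  have h2 : (2 * n + 1 + 1).choose (n + 1) = 2 * (2 * n + 1).choose (n + 1) := by
    rw [Nat.choose_succ_succ' (2 * n + 1) n, Nat.choose_symm_half]; ring
  rw [h1, h2]
  have h' : (2 * N_D (2 * n + 1) : ℚ) = N_C (2 * n + 1) + (2 * n + 1).choose (n + 1) := by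
    exact_mod_cast h
  rw [h']; push_cast; ring
end
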